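/- arXiv:2304.07860 — 2 statements merged into one kernel-verified Lean document; each statement's English description precedes it below -/
import Mathlib

section
/- Let S = (S_t)_{t≥0} be the solution flow of the periodic Cucker–Smale system on 𝕋^{nN} × ℝ^{nN}, and let F ⊆ 𝕋^{nN} × ℝ^{nN} be a measurable set contained in {max_i |v_i| ≤ R} for some R > 0 such that for some M > 0 every datum in F satisfies ∫_0^∞ Σ_{i≠j} φ(x_i(s) − x_j(s)) ds ≤ M along its solution. Then for almost every initial datum (x₀, v₀) ∈ F the solution satisfies d_{𝕋^n}(x_i(t) − x_j(t)) ≥ r₀ for all i ≠ j and all t ≥ 0. -/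
open Set MeasureTheory Filter

/-- The point of `ℝ^n` with coordinates `2π k a`, i.e. a point of the lattice `(2πℤ)^n`. -/
noncomputable def latticePoint {n : ℕ} (k : Fin n → ℤ) : EuclideanSpace ℝ (Fin n) :=
  (WithLp.equiv 2 (Fin n → ℝ)).symm fun a => 2 * Real.pi * (k a : ℝ)

/-- Torus distance to the origin on `𝕋^n = (ℝ/2πℤ)^n`. -/
noncomputable def dTorus {n : ℕ} (z : EuclideanSpace ℝ (Fin n)) : ℝ :=
  ⨅ k : Fin n → ℤ, ‖z + latticePoint k‖

/-! ## Basic objects -/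

abbrev EE (n : ℕ) := EuclideanSpace ℝ (Fin n)
abbrev XX (n N : ℕ) := Fin N → EuclideanSpace ℝ (Fin n)

/-- acceleration -/
noncomputable def acc {n N : ℕ} (φ : EE n → ℝ) (x v : XX n N) : XX n N :=
  fun i => (N : ℝ)⁻¹ • ∑ j, φ (x i - x j) • (v j - v i)

/-- total interaction -/
noncomputable def psi {n N : ℕ} (φ : EE n → ℝ) (x : XX n N) : ℝ :=
  ∑ i, ∑ j ∈ Finset.univ.erase i, φ (x i - x j)

/-- kernel hypotheses -/
structure Ker (n N : ℕ) (φ : EE n → ℝ) (B l : ℝ) : Prop where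
  hN : 1 ≤ N
  hB : 0 ≤ B
  hl : 0 ≤ l
  nonneg : ∀ z, 0 ≤ φ z
  bdd : ∀ z, φ z ≤ B
  lip : ∀ z w, |φ z - φ w| ≤ l * ‖z - w‖
  per : ∀ z (k : Fin n → ℤ), φ (z + latticePoint k) = φ z

def IsSol {n N : ℕ} (φ : EE n → ℝ) (y : ℝ → XX n N × XX n N) : Prop :=
  ∀ t ∈ Ici (0 : ℝ), HasDerivWithinAt y ((y t).2, acc φ (y t).1 (y t).2) (Ici 0) t

section
variable {n N : ℕ} {φ : EE n → ℝ} {B l : ℝ}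

lemma psi_nonneg (K : Ker n N φ B l) (x : XX n N) : 0 ≤ psi φ x :=
  Finset.sum_nonneg fun _ _ => Finset.sum_nonneg fun _ _ => K.nonneg _

lemma psi_le (K : Ker n N φ B l) (x : XX n N) : psi φ x ≤ N * (N * B) := by
  unfold psi
  calc _ ≤ ∑ i : Fin N, ∑ j : Fin N, B := by
        refine Finset.sum_le_sum fun i _ => ?_
        refine (Finset.sum_le_sum fun j _ => K.bdd _).trans ?_
        exact Finset.sum_le_sum_of_subset_of_nonneg (Finset.erase_subset _ _) fun _ _ _ => K.hB
    _ = _ := by simp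

lemma phi_diff (K : Ker n N φ B l) (x x' : XX n N) (i j : Fin N) :
    |φ (x i - x j) - φ (x' i - x' j)| ≤ 2 * l * ‖x - x'‖ := by
  refine (K.lip _ _).trans ?_
  have h1 : ‖(x i - x j) - (x' i - x' j)‖ ≤ 2 * ‖x - x'‖ := by
    have : (x i - x j) - (x' i - x' j) = (x - x') i - (x - x') j := by simp; abel
    rw [this]
    refine (norm_sub_le _ _).trans ?_
    linarith [norm_le_pi_norm (x - x') i, norm_le_pi_norm (x - x') j]
  nlinarith [K.hl]

lemma psi_lip (K : Ker n N φ B l) (x x' : XX n N) :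
    |psi φ x - psi φ x'| ≤ N * (N * (2 * l)) * ‖x - x'‖ := by
  unfold psi
  rw [← Finset.sum_sub_distrib]
  simp_rw [← Finset.sum_sub_distrib]
  calc _ ≤ ∑ i : Fin N, ∑ j : Fin N, 2 * l * ‖x - x'‖ := by
        refine (Finset.abs_sum_le_sum_abs _ _).trans (Finset.sum_le_sum fun i _ => ?_)
        refine (Finset.abs_sum_le_sum_abs _ _).trans ?_
        refine (Finset.sum_le_sum fun j _ => phi_diff K x x' i j).trans ?_
        exact Finset.sum_le_sum_of_subset_of_nonneg (Finset.erase_subset _ _) fun _ _ _ => by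
          have := K.hl; positivity
    _ = _ := by simp; ring

lemma Ninv_le (K : Ker n N φ B l) : (N : ℝ)⁻¹ ≤ 1 := by
  have : (1 : ℝ) ≤ N := by exact_mod_cast K.hN
  exact inv_le_one_of_one_le₀ this

lemma acc_sub (x v w : XX n N) : acc φ x (v - w) = acc φ x v - acc φ x w := by
  ext1 i
  simp only [acc, Pi.sub_apply]
  rw [← smul_sub, ← Finset.sum_sub_distrib]
  congr 1
  refine Finset.sum_congr rfl fun j _ => ?_
  rw [← smul_sub]; congr 1; abel

lemma sub_norm_le (v : XX n N) (i j : Fin N) : ‖v j - v i‖ ≤ 2 * ‖v‖ := by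
  refine (norm_sub_le _ _).trans ?_
  linarith [norm_le_pi_norm v i, norm_le_pi_norm v j]

lemma acc_le_psi (K : Ker n N φ B l) (x v : XX n N) : ‖acc φ x v‖ ≤ 2 * psi φ x * ‖v‖ := by
  have hp := psi_nonneg K x
  rw [pi_norm_le_iff_of_nonneg (by positivity)]
  intro i
  have h0 : ‖∑ j, φ (x i - x j) • (v j - v i)‖ ≤ 2 * psi φ x * ‖v‖ := by
    rw [← Finset.sum_erase (a := i) Finset.univ (by simp)]
    calc _ ≤ ∑ j ∈ Finset.univ.erase i, φ (x i - x j) * (2 * ‖v‖) := by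
          refine (norm_sum_le _ _).trans (Finset.sum_le_sum fun j _ => ?_)
          rw [norm_smul, Real.norm_of_nonneg (K.nonneg _)]
          exact mul_le_mul_of_nonneg_left (sub_norm_le v i j) (K.nonneg _)
      _ = (∑ j ∈ Finset.univ.erase i, φ (x i - x j)) * (2 * ‖v‖) := by rw [Finset.sum_mul]
      _ ≤ psi φ x * (2 * ‖v‖) := by
          refine mul_le_mul_of_nonneg_right ?_ (by positivity)
          exact Finset.single_le_sum (f := fun i => ∑ j ∈ Finset.univ.erase i, φ (x i - x j))
            (fun i _ => Finset.sum_nonneg fun _ _ => K.nonneg _) (Finset.mem_univ i)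
      _ = _ := by ring
  unfold acc
  rw [norm_smul, Real.norm_of_nonneg (by positivity)]
  nlinarith [Ninv_le K, norm_nonneg (∑ j, φ (x i - x j) • (v j - v i))]

lemma acc_diff (K : Ker n N φ B l) (x x' w : XX n N) :
    ‖acc φ x w - acc φ x' w‖ ≤ 4 * l * ‖w‖ * ‖x - x'‖ := by
  have hl := K.hl
  rw [pi_norm_le_iff_of_nonneg (by positivity)]
  intro i
  have hN : (0 : ℝ) < N := by exact_mod_cast K.hN
  have h0 : ‖∑ j, (φ (x i - x j) - φ (x' i - x' j)) • (w j - w i)‖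
      ≤ N * (4 * l * ‖w‖ * ‖x - x'‖) := by
    calc _ ≤ ∑ j : Fin N, (2 * l * ‖x - x'‖) * (2 * ‖w‖) := by
          refine (norm_sum_le _ _).trans (Finset.sum_le_sum fun j _ => ?_)
          rw [norm_smul]
          exact mul_le_mul (phi_diff K x x' i j) (sub_norm_le w i j) (norm_nonneg _)
            (by positivity)
      _ = _ := by
          rw [Finset.sum_const, Finset.card_univ, Fintype.card_fin, nsmul_eq_mul]; ring
  have h1 : (acc φ x w - acc φ x' w) i =
      (N : ℝ)⁻¹ • ∑ j, (φ (x i - x j) - φ (x' i - x' j)) • (w j - w i) := by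
    simp only [acc, Pi.sub_apply]
    rw [← smul_sub, ← Finset.sum_sub_distrib]
    simp_rw [sub_smul]
  rw [h1, norm_smul, Real.norm_of_nonneg (by positivity), inv_mul_le_iff₀ hN]
  exact h0

lemma euler_norm_le (K : Ker n N φ B l) (x v : XX n N) (h : ℝ) (hh : 0 ≤ h) (hB : h * B ≤ 1) :
    ‖v + h • acc φ x v‖ ≤ ‖v‖ := by
  rw [pi_norm_le_iff_of_nonneg (by positivity)]
  intro i
  have hN : (0 : ℝ) < N := by exact_mod_cast K.hN
  set s := h * ((N : ℝ)⁻¹ * ∑ j, φ (x i - x j)) with hs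
  have hsum0 : 0 ≤ ∑ j, φ (x i - x j) := Finset.sum_nonneg fun _ _ => K.nonneg _
  have hs0 : 0 ≤ s := by positivity
  have hs1 : s ≤ 1 := by
    refine le_trans ?_ hB
    refine mul_le_mul_of_nonneg_left ?_ hh
    rw [inv_mul_le_iff₀ hN]
    refine (Finset.sum_le_sum fun j _ => K.bdd _).trans ?_
    simp
  have e : (v + h • acc φ x v) i = (1 - s) • v i + h • (N : ℝ)⁻¹ • ∑ j, φ (x i - x j) • v j := by
    simp only [acc, Pi.add_apply, Pi.smul_apply, smul_sub, Finset.sum_sub_distrib]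
    rw [← Finset.sum_smul, hs, sub_smul, mul_smul, mul_smul, one_smul]
    abel
  rw [e]
  have h2 : ‖∑ j, φ (x i - x j) • v j‖ ≤ (∑ j, φ (x i - x j)) * ‖v‖ := by
    rw [Finset.sum_mul]
    refine (norm_sum_le _ _).trans (Finset.sum_le_sum fun j _ => ?_)
    rw [norm_smul, Real.norm_of_nonneg (K.nonneg _)]
    exact mul_le_mul_of_nonneg_left (norm_le_pi_norm v j) (K.nonneg _)
  refine (norm_add_le _ _).trans ?_
  rw [norm_smul, norm_smul, norm_smul, Real.norm_of_nonneg (by linarith), Real.norm_of_nonneg hh,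
    Real.norm_of_nonneg (by positivity)]
  have h3 : h * ((N : ℝ)⁻¹ * ‖∑ j, φ (x i - x j) • v j‖) ≤ s * ‖v‖ := by
    rw [hs, mul_assoc, mul_assoc]
    gcongr
  have h4 : (1 - s) * ‖v i‖ ≤ (1 - s) * ‖v‖ :=
    mul_le_mul_of_nonneg_left (norm_le_pi_norm v i) (by linarith)
  linarith

lemma IsSol.continuousOn {y : ℝ → XX n N × XX n N} (hy : IsSol φ y) : ContinuousOn y (Ici 0) :=
  fun t ht => (hy t ht).continuousWithinAt

lemma IsSol.hx {y : ℝ → XX n N × XX n N} (hy : IsSol φ y) {t : ℝ} (ht : 0 ≤ t) :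
    HasDerivWithinAt (fun s => (y s).1) (y t).2 (Ici 0) t :=
  (hasFDerivAt_fst.comp_hasDerivWithinAt t (hy t ht) :)

lemma IsSol.hv {y : ℝ → XX n N × XX n N} (hy : IsSol φ y) {t : ℝ} (ht : 0 ≤ t) :
    HasDerivWithinAt (fun s => (y s).2) (acc φ (y t).1 (y t).2) (Ici 0) t :=
  (hasFDerivAt_snd.comp_hasDerivWithinAt t (hy t ht) :)

/-- maximum principle for velocities -/
lemma IsSol.vel (K : Ker n N φ B l) {y : ℝ → XX n N × XX n N} (hy : IsSol φ y) {t : ℝ}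
    (ht : 0 ≤ t) : ‖(y t).2‖ ≤ ‖(y 0).2‖ := by
  have hc : ContinuousOn (fun s => ‖(y s).2‖) (Icc 0 t) :=
    (continuous_norm.comp_continuousOn (continuous_snd.comp_continuousOn hy.continuousOn)).mono
      Icc_subset_Ici_self
  refine image_le_of_liminf_slope_right_le_deriv_boundary hc (B := fun _ => ‖(y 0).2‖)
    (B' := fun _ => 0) le_rfl continuousOn_const (fun x _ => hasDerivWithinAt_const _ _ _) ?_
    (right_mem_Icc.2 ht)
  intro x hx r hr
  apply Eventually.frequently
  have h1 := ((hy.hv hx.1).mono (Ioi_subset_Ici hx.1 : Ioi x ⊆ Ici 0))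
  rw [hasDerivWithinAt_iff_isLittleO] at h1
  have h2 := h1.def (half_pos hr)
  have h3 : ∀ᶠ z in nhdsWithin x (Ioi x), (z - x) * B < 1 := by
    have : Tendsto (fun z => (z - x) * B) (nhds x) (nhds 0) := by
      have : Continuous (fun z => (z - x) * B) := by fun_prop
      simpa using this.tendsto x
    exact (this.eventually (gt_mem_nhds one_pos)).filter_mono nhdsWithin_le_nhds
  filter_upwards [h2, h3, self_mem_nhdsWithin] with z hz hz3 hzx
  have hzx' : 0 < z - x := sub_pos.2 hzx
  rw [slope_def_field, div_lt_iff₀ hzx']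
  rw [Real.norm_of_nonneg hzx'.le] at hz
  have h5 := euler_norm_le K (y x).1 (y x).2 (z - x) hzx'.le hz3.le
  have h6 : ‖(y z).2‖ ≤ ‖(y z).2 - (y x).2 - (z - x) • acc φ (y x).1 (y x).2‖ +
      ‖(y x).2 + (z - x) • acc φ (y x).1 (y x).2‖ := by
    refine le_trans (le_of_eq ?_) (norm_add_le _ _)
    congr 1; abel
  nlinarith
end

section
variable {n N : ℕ} {φ : EE n → ℝ} {B l : ℝ}

/-- the vector field -/
noncomputable def vf (φ : EE n → ℝ) (p : XX n N × XX n N) : XX n N × XX n N :=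
  (p.2, acc φ p.1 p.2)

/-- Lipschitz constant of the vector field on `‖v‖ ≤ R` -/
noncomputable def KK (N : ℕ) (B l R : ℝ) : ℝ := 1 + 2 * (N * (N * B)) + 4 * l * R

lemma KK_pos (K : Ker n N φ B l) {R : ℝ} (hR : 0 ≤ R) : 1 ≤ KK N B l R := by
  have := K.hB; have := K.hl
  unfold KK
  have : 0 ≤ 2 * (N * (N * B)) + 4 * l * R := by positivity
  linarith

lemma acc_full (K : Ker n N φ B l) (p q : XX n N × XX n N) :
    ‖acc φ p.1 p.2 - acc φ q.1 q.2‖ ≤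
      2 * psi φ p.1 * ‖p.2 - q.2‖ + 4 * l * ‖q.2‖ * ‖p.1 - q.1‖ := by
  have e : acc φ p.1 p.2 - acc φ q.1 q.2 =
      acc φ p.1 (p.2 - q.2) + (acc φ p.1 q.2 - acc φ q.1 q.2) := by
    rw [acc_sub]; abel
  rw [e]
  refine (norm_add_le _ _).trans (add_le_add ?_ ?_)
  · exact acc_le_psi K _ _
  · exact acc_diff K _ _ _

lemma vf_lip (K : Ker n N φ B l) {R : ℝ} (hR : 0 ≤ R) (p q : XX n N × XX n N)
    (hq : ‖q.2‖ ≤ R) : ‖vf φ p - vf φ q‖ ≤ KK N B l R * ‖p - q‖ := by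
  have h1 : ‖p.1 - q.1‖ ≤ ‖p - q‖ := norm_fst_le (p - q)
  have h2 : ‖p.2 - q.2‖ ≤ ‖p - q‖ := norm_snd_le (p - q)
  have hB := K.hB
  have hl := K.hl
  have hk := KK_pos K hR
  refine norm_prod_le_iff.2 ⟨?_, ?_⟩
  · change ‖p.2 - q.2‖ ≤ _
    nlinarith [norm_nonneg (p - q)]
  · change ‖acc φ p.1 p.2 - acc φ q.1 q.2‖ ≤ _
    have h3 : 2 * psi φ p.1 * ‖p.2 - q.2‖ ≤ 2 * (N * (N * B)) * ‖p - q‖ := by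
      have := psi_le K p.1
      gcongr
    have h4 : 4 * l * ‖q.2‖ * ‖p.1 - q.1‖ ≤ 4 * l * R * ‖p - q‖ := by
      gcongr
    have := acc_full K p q
    unfold KK
    nlinarith [norm_nonneg (p - q)]

lemma gron (K : Ker n N φ B l) {R : ℝ} (hR : 0 ≤ R) {y z : ℝ → XX n N × XX n N}
    (hy : IsSol φ y) (hz : IsSol φ z) (hy0 : ‖(y 0).2‖ ≤ R) (hz0 : ‖(z 0).2‖ ≤ R)
    {t : ℝ} (ht : 0 ≤ t) : ‖y t - z t‖ ≤ ‖y 0 - z 0‖ * Real.exp (KK N B l R * t) := by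
  have hk := KK_pos K hR
  have hlip : LipschitzOnWith (KK N B l R).toNNReal (vf φ) {p : XX n N × XX n N | ‖p.2‖ ≤ R} := by
    refine LipschitzOnWith.of_dist_le_mul fun p hp q hq => ?_
    rw [dist_eq_norm, dist_eq_norm, Real.coe_toNNReal _ (by linarith)]
    exact vf_lip K hR p q hq
  have := dist_le_of_trajectories_ODE_of_mem (v := fun _ => vf φ)
    (s := fun _ => {p : XX n N × XX n N | ‖p.2‖ ≤ R}) (K := (KK N B l R).toNNReal)
    (f := y) (g := z) (a := 0) (b := t) (δ := ‖y 0 - z 0‖)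
    (fun _ _ => hlip) (hy.continuousOn.mono Icc_subset_Ici_self)
    (fun s hs => (hy s hs.1).mono (Ici_subset_Ici.2 hs.1))
    (fun s hs => (hy.vel K hs.1).trans hy0)
    (hz.continuousOn.mono Icc_subset_Ici_self)
    (fun s hs => (hz s hs.1).mono (Ici_subset_Ici.2 hs.1))
    (fun s hs => (hz.vel K hs.1).trans hz0) (by rw [dist_eq_norm]) t (right_mem_Icc.2 ht)
  rwa [dist_eq_norm, Real.coe_toNNReal _ (by linarith), sub_zero] at this

/-- mean value inequality from `0` -/
lemma mv {E : Type*} [NormedAddCommGroup E] [NormedSpace ℝ E] {f f' : ℝ → E} {h C : ℝ}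
    (hh : 0 ≤ h) (hf : ∀ s, 0 ≤ s → s ≤ h → HasDerivWithinAt f (f' s) (Ici 0) s)
    (hC : ∀ s, 0 ≤ s → s ≤ h → ‖f' s‖ ≤ C) : ‖f h - f 0‖ ≤ C * h := by
  have := (convex_Icc (0 : ℝ) h).norm_image_sub_le_of_norm_hasDerivWithin_le
    (fun s hs => (hf s hs.1 hs.2).mono Icc_subset_Ici_self) (fun s hs => hC s hs.1 hs.2)
    (left_mem_Icc.2 hh) (right_mem_Icc.2 hh)
  rwa [sub_zero, Real.norm_of_nonneg hh] at this

lemma pos_move (K : Ker n N φ B l) {R : ℝ} {y : ℝ → XX n N × XX n N}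
    (hy : IsSol φ y) (hy0 : ‖(y 0).2‖ ≤ R) {t : ℝ} (ht : 0 ≤ t) :
    ‖(y t).1 - (y 0).1‖ ≤ R * t :=
  mv ht (fun _ hs _ => hy.hx hs) fun _ hs _ => (hy.vel K hs).trans hy0

lemma psi_move (K : Ker n N φ B l) {R : ℝ} {y : ℝ → XX n N × XX n N}
    (hy : IsSol φ y) (hy0 : ‖(y 0).2‖ ≤ R) {t : ℝ} (ht : 0 ≤ t) :
    |psi φ (y t).1 - psi φ (y 0).1| ≤ N * (N * (2 * l)) * R * t := by
  refine (psi_lip K _ _).trans ?_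
  have := pos_move K hy hy0 ht
  have := K.hl
  rw [mul_assoc _ R t]
  gcongr

lemma est1 (K : Ker n N φ B l) {R : ℝ} (hR : 0 ≤ R) {y z : ℝ → XX n N × XX n N}
    (hy : IsSol φ y) (hz : IsSol φ z) (hy0 : ‖(y 0).2‖ ≤ R) (hz0 : ‖(z 0).2‖ ≤ R)
    {s : ℝ} (hs : 0 ≤ s) (hs1 : s ≤ 1) :
    ‖vf φ (y s) - vf φ (z s)‖ ≤ KK N B l R * Real.exp (KK N B l R) * ‖y 0 - z 0‖ := by
  have hk := KK_pos K hR
  refine (vf_lip K hR _ _ ((hz.vel K hs).trans hz0)).trans ?_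
  have h1 := gron K hR hy hz hy0 hz0 hs
  have h2 : Real.exp (KK N B l R * s) ≤ Real.exp (KK N B l R) := by
    apply Real.exp_le_exp.2; nlinarith
  rw [mul_assoc]
  refine mul_le_mul_of_nonneg_left (h1.trans ?_) (by linarith)
  rw [mul_comm]
  gcongr

lemma est2 (K : Ker n N φ B l) {R : ℝ} (hR : 0 ≤ R) {y z : ℝ → XX n N × XX n N}
    (hy : IsSol φ y) (hz : IsSol φ z) (hy0 : ‖(y 0).2‖ ≤ R) (hz0 : ‖(z 0).2‖ ≤ R)
    {s : ℝ} (hs : 0 ≤ s) (hs1 : s ≤ 1) :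
    ‖(y s - z s) - (y 0 - z 0)‖ ≤ KK N B l R * Real.exp (KK N B l R) * ‖y 0 - z 0‖ * s :=
  mv (f := fun s => y s - z s) (f' := fun s => vf φ (y s) - vf φ (z s)) hs
    (fun t h0 _ => (hy t h0).sub (hz t h0))
    fun _ h0 h1 => est1 K hR hy hz hy0 hz0 h0 (h1.trans hs1)

lemma est_x (K : Ker n N φ B l) {R : ℝ} (hR : 0 ≤ R) {y z : ℝ → XX n N × XX n N}
    (hy : IsSol φ y) (hz : IsSol φ z) (hy0 : ‖(y 0).2‖ ≤ R) (hz0 : ‖(z 0).2‖ ≤ R)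
    {h : ℝ} (hs : 0 ≤ h) (hs1 : h ≤ 1) :
    ‖((y h).1 - h • (y h).2 - ((z h).1 - h • (z h).2)) - ((y 0).1 - (z 0).1)‖ ≤
      h * (KK N B l R * Real.exp (KK N B l R) * ‖y 0 - z 0‖) * h := by
  have := mv (f := fun s => (y s).1 - s • (y s).2 - ((z s).1 - s • (z s).2))
    (f' := fun s => ((y s).2 - (s • acc φ (y s).1 (y s).2 + (1 : ℝ) • (y s).2)) -
      ((z s).2 - (s • acc φ (z s).1 (z s).2 + (1 : ℝ) • (z s).2)))
    (C := h * (KK N B l R * Real.exp (KK N B l R) * ‖y 0 - z 0‖)) hs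
    (fun t h0 _ => ((hy.hx h0).sub ((hasDerivWithinAt_id t _).smul (hy.hv h0))).sub
      ((hz.hx h0).sub ((hasDerivWithinAt_id t _).smul (hz.hv h0)))) ?_
  · simpa using this
  · intro s h0 h1
    have e : ((y s).2 - (s • acc φ (y s).1 (y s).2 + (1 : ℝ) • (y s).2)) -
      ((z s).2 - (s • acc φ (z s).1 (z s).2 + (1 : ℝ) • (z s).2)) =
      s • (-(acc φ (y s).1 (y s).2 - acc φ (z s).1 (z s).2)) := by module
    rw [e, norm_smul, norm_neg, Real.norm_of_nonneg h0]
    have h3 : ‖acc φ (y s).1 (y s).2 - acc φ (z s).1 (z s).2‖ ≤ ‖vf φ (y s) - vf φ (z s)‖ :=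
      norm_snd_le (vf φ (y s) - vf φ (z s))
    exact mul_le_mul h1 (h3.trans (est1 K hR hy hz hy0 hz0 h0 (h1.trans hs1))) (norm_nonneg _) hs

lemma est_v (K : Ker n N φ B l) {R : ℝ} (hR : 0 ≤ R) : ∃ C2 : ℝ, 0 ≤ C2 ∧
    ∀ {y z : ℝ → XX n N × XX n N},
    IsSol φ y → IsSol φ z → ‖(y 0).2‖ ≤ R → ‖(z 0).2‖ ≤ R → ∀ {h : ℝ}, 0 ≤ h → h ≤ 1 →
    ‖((y h).2 - (z h).2) - ((y 0).2 - (z 0).2)‖ ≤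
      (2 * psi φ (y 0).1 * ‖(y 0).2 - (z 0).2‖ + 4 * l * R * ‖(y 0).1 - (z 0).1‖
        + C2 * h * ‖y 0 - z 0‖) * h := by
  have hk := KK_pos K hR
  have hB := K.hB
  have hl := K.hl
  set K1 := KK N B l R * Real.exp (KK N B l R) with hK1
  have hK1p : 0 ≤ K1 := by positivity
  set c : ℝ := N * (N * (2 * l)) * R with hc
  have hc0 : 0 ≤ c := by positivity
  set P : ℝ := N * (N * B) with hP
  have hP0 : 0 ≤ P := by positivity
  refine ⟨2 * P * K1 + 2 * c + 2 * c * K1 + 4 * l * R * K1, by positivity, ?_⟩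
  intro y z hy hz hy0 hz0 h h0 h1
  refine mv (f := fun s => (y s).2 - (z s).2)
    (f' := fun s => acc φ (y s).1 (y s).2 - acc φ (z s).1 (z s).2) h0
    (fun t ht _ => (hy.hv ht).sub (hz.hv ht)) ?_
  intro s hs hsh
  refine (acc_full K (y s) (z s)).trans ?_
  set a := ‖y 0 - z 0‖ with ha
  have ha0 : 0 ≤ a := norm_nonneg _
  have e2 := est2 K hR hy hz hy0 hz0 hs (hsh.trans h1)
  rw [← hK1, ← ha] at e2
  have e2' : K1 * a * s ≤ K1 * a * h := by gcongr
  have hv : ‖(y s).2 - (z s).2‖ ≤ ‖(y 0).2 - (z 0).2‖ + K1 * a * h := by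
    have : ‖((y s).2 - (z s).2) - ((y 0).2 - (z 0).2)‖ ≤ K1 * a * s :=
      (norm_snd_le ((y s - z s) - (y 0 - z 0))).trans e2
    have h3 := norm_sub_norm_le ((y s).2 - (z s).2) ((y 0).2 - (z 0).2)
    linarith
  have hx : ‖(y s).1 - (z s).1‖ ≤ ‖(y 0).1 - (z 0).1‖ + K1 * a * h := by
    have : ‖((y s).1 - (z s).1) - ((y 0).1 - (z 0).1)‖ ≤ K1 * a * s :=
      (norm_fst_le ((y s - z s) - (y 0 - z 0))).trans e2
    have h3 := norm_sub_norm_le ((y s).1 - (z s).1) ((y 0).1 - (z 0).1)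
    linarith
  have hp : psi φ (y s).1 ≤ psi φ (y 0).1 + c * h := by
    have h3 := (abs_le.1 (psi_move K hy hy0 hs)).2
    have : c * s ≤ c * h := by gcongr
    linarith
  have hp0 := psi_nonneg K (y 0).1
  have hpP : psi φ (y 0).1 ≤ P := psi_le K _
  have hva : ‖(y 0).2 - (z 0).2‖ ≤ a := norm_snd_le (y 0 - z 0)
  have hzR : ‖(z s).2‖ ≤ R := (hz.vel K hs).trans hz0
  set p0 := psi φ (y 0).1
  set v0 := ‖(y 0).2 - (z 0).2‖
  set x0 := ‖(y 0).1 - (z 0).1‖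
  have hv0 : 0 ≤ v0 := norm_nonneg _
  calc 2 * psi φ (y s).1 * ‖(y s).2 - (z s).2‖ + 4 * l * ‖(z s).2‖ * ‖(y s).1 - (z s).1‖
      ≤ 2 * (p0 + c * h) * (v0 + K1 * a * h) + 4 * l * R * (x0 + K1 * a * h) := by gcongr
    _ = 2 * p0 * v0 + 4 * l * R * x0 +
        (2 * p0 * (K1 * a * h) + 2 * c * h * v0 + 2 * c * K1 * a * h * h +
          4 * l * R * K1 * a * h) := by ring
    _ ≤ 2 * p0 * v0 + 4 * l * R * x0 +
        (2 * P * (K1 * a * h) + 2 * c * h * a + 2 * c * K1 * a * h * 1 +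
          4 * l * R * K1 * a * h) := by gcongr
    _ = _ := by ring
end

section
variable {n N : ℕ} {φ : EE n → ℝ} {B l : ℝ}

lemma vol_comp {E : Type*} [NormedAddCommGroup E] [NormedSpace ℝ E] [FiniteDimensional ℝ E]
    [MeasurableSpace E] [BorelSpace E] (μ : Measure E) [μ.IsAddHaarMeasure]
    (p q : E → E) (s : Set E) (C : ℝ) (hC : 0 ≤ C)
    (h : ∀ x ∈ s, ∀ y ∈ s, ‖p x - p y‖ ≤ C * ‖q x - q y‖) :
    μ (p '' s) ≤ ENNReal.ofReal (C ^ Module.finrank ℝ E) * μ (q '' s) := by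
  classical
  rcases s.eq_empty_or_nonempty with rfl | ⟨x0, hx0⟩
  · simp
  have hq : ∀ u : E, ∃ x, u ∈ q '' s → x ∈ s ∧ q x = u := by
    intro u
    by_cases hu : u ∈ q '' s
    · obtain ⟨x, hx, e⟩ := hu
      exact ⟨x, fun _ => ⟨hx, e⟩⟩
    · exact ⟨x0, fun h => absurd h hu⟩
  choose g hg using hq
  have e : p '' s = (p ∘ g) '' (q '' s) := by
    ext w
    constructor
    · rintro ⟨x, hx, rfl⟩
      refine ⟨q x, ⟨x, hx, rfl⟩, ?_⟩
      have h1 := hg (q x) ⟨x, hx, rfl⟩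
      have h2 := h (g (q x)) h1.1 x hx
      rw [h1.2, sub_self, norm_zero, mul_zero] at h2
      exact sub_eq_zero.1 (norm_le_zero_iff.1 h2)
    · rintro ⟨u, hu, rfl⟩
      exact ⟨g u, (hg u hu).1, rfl⟩
  have hL : LipschitzOnWith C.toNNReal (p ∘ g) (q '' s) := by
    refine LipschitzOnWith.of_dist_le_mul fun u hu w hw => ?_
    rw [dist_eq_norm, dist_eq_norm, Real.coe_toNNReal _ hC]
    have := h _ (hg u hu).1 _ (hg w hw).1
    rwa [(hg u hu).2, (hg w hw).2] at this
  have h3 := hL.hausdorffMeasure_image_le (d := Module.finrank ℝ E) (by positivity)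
  rw [← e] at h3
  have h4 : μ = (μ.addHaarScalarFactor (Measure.hausdorffMeasure (Module.finrank ℝ E : ℝ))) •
      (Measure.hausdorffMeasure (Module.finrank ℝ E : ℝ) : Measure E) :=
    Measure.isAddLeftInvariant_eq_smul _ _
  rw [h4]
  simp only [Measure.smul_apply, ENNReal.smul_def, smul_eq_mul]
  rw [mul_left_comm]
  gcongr
  rw [ENNReal.rpow_natCast] at h3
  rwa [ENNReal.ofReal_pow hC]

/-- scaling of velocities -/
def Lam (lam : ℝ) : (XX n N × XX n N) →ₗ[ℝ] (XX n N × XX n N) where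
  toFun p := (p.1, lam • p.2)
  map_add' p q := by ext1 <;> simp
  map_smul' c p := by
    ext1
    · simp
    · exact smul_comm lam c p.2

/-- shear -/
def Shr (h : ℝ) : (XX n N × XX n N) →ₗ[ℝ] (XX n N × XX n N) where
  toFun p := (p.1 - h • p.2, p.2)
  map_add' p q := by
    ext1
    · simp; abel
    · simp
  map_smul' c p := by
    ext1
    · change c • p.1 - h • c • p.2 = c • (p.1 - h • p.2)
      rw [smul_sub, smul_comm]
    · simp

lemma Lam_det_ne {lam : ℝ} (h : 0 < lam) :
    LinearMap.det (Lam lam : (XX n N × XX n N) →ₗ[ℝ] _) ≠ 0 := by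
  have e : (Lam lam : (XX n N × XX n N) →ₗ[ℝ] _) ∘ₗ Lam lam⁻¹ = LinearMap.id := by
    refine LinearMap.ext fun p => Prod.ext rfl ?_
    change lam • lam⁻¹ • p.2 = p.2
    rw [smul_smul, mul_inv_cancel₀ h.ne', one_smul]
  have := congrArg LinearMap.det e
  rw [LinearMap.det_comp, LinearMap.det_id] at this
  intro h0
  simp [h0] at this

lemma Shr_det (h : ℝ) : |LinearMap.det (Shr h : (XX n N × XX n N) →ₗ[ℝ] _)| = 1 := by
  have e : (Lam (-1) : (XX n N × XX n N) →ₗ[ℝ] _) ∘ₗ Lam (-1) = LinearMap.id := by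
    refine LinearMap.ext fun p => Prod.ext rfl ?_
    change (-1 : ℝ) • (-1 : ℝ) • p.2 = p.2
    module
  have e2 : (Shr h : (XX n N × XX n N) →ₗ[ℝ] _) ∘ₗ (Lam (-1) ∘ₗ Shr h ∘ₗ Lam (-1)) =
      LinearMap.id := by
    refine LinearMap.ext fun p => Prod.ext ?_ ?_
    · change (p.1 - h • (-1 : ℝ) • p.2) - h • (-1 : ℝ) • (-1 : ℝ) • p.2 = p.1
      module
    · change (-1 : ℝ) • (-1 : ℝ) • p.2 = p.2
      module
  have h1 := congrArg LinearMap.det e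
  have h2 := congrArg LinearMap.det e2
  simp only [LinearMap.det_comp, LinearMap.det_id] at h1 h2
  have h3 : LinearMap.det (Shr h : (XX n N × XX n N) →ₗ[ℝ] _) ^ 2 = 1 := by
    rw [← h2, pow_two]
    linear_combination (-(LinearMap.det (Shr h : (XX n N × XX n N) →ₗ[ℝ] _)) ^ 2) * h1
  rwa [← pow_eq_one_iff_of_nonneg (abs_nonneg _) two_ne_zero, sq_abs]
  
set_option maxHeartbeats 1000000 in
lemma lam_est (K : Ker n N φ B l) {R : ℝ} (hR : 0 ≤ R) {η : ℝ} (hη : 0 < η) :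
    ∃ lam : ℝ, 0 < lam ∧ ∃ h0 : ℝ, 0 < h0 ∧ h0 ≤ 1 ∧ ∀ h : ℝ, 0 ≤ h → h ≤ h0 →
    ∀ {y z : ℝ → XX n N × XX n N},
    IsSol φ y → IsSol φ z → ‖(y 0).2‖ ≤ R → ‖(z 0).2‖ ≤ R →
    ‖Lam lam (y 0) - Lam lam (z 0)‖ ≤ Real.exp (2 * (h * (2 * psi φ (y 0).1 + η))) *
      ‖Lam lam (Shr h (y h)) - Lam lam (Shr h (z h))‖ := by
  obtain ⟨C2, hC2, HV⟩ := est_v K hR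
  have hk := KK_pos K hR
  have hB := K.hB
  have hl := K.hl
  set K1 := KK N B l R * Real.exp (KK N B l R) with hK1
  have hK1p : 0 ≤ K1 := by positivity
  set P : ℝ := N * (N * B) with hP
  have hP0 : 0 ≤ P := by positivity
  obtain ⟨lam, hlam, hlam1, hlamη⟩ : ∃ lam : ℝ, 0 < lam ∧ lam ≤ 1 ∧ 4 * l * R * lam ≤ η / 2 := by
    refine ⟨min 1 (η / 2 / (4 * l * R + 1)), by positivity, min_le_left _ _, ?_⟩
    calc 4 * l * R * min 1 (η / 2 / (4 * l * R + 1))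
        ≤ (4 * l * R + 1) * (η / 2 / (4 * l * R + 1)) := by
          gcongr
          · linarith
          · exact min_le_right _ _
      _ = η / 2 := by field_simp
  obtain ⟨h0, hh0, hh1, hhx, hhv, hhe⟩ : ∃ h0 : ℝ, 0 < h0 ∧ h0 ≤ 1 ∧ h0 * (K1 / lam) ≤ η ∧
      h0 * C2 ≤ η / 2 ∧ h0 * (2 * P + η) ≤ 1 / 2 := by
    set D := 1 + K1 / lam / η + 2 * C2 / η + 2 * (2 * P + η) with hD
    have hD1 : 1 ≤ D := by
      have : 0 ≤ K1 / lam / η + 2 * C2 / η + 2 * (2 * P + η) := by positivity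
      linarith
    have d1 : K1 / lam / η ≤ D := by
      have : 0 ≤ 1 + 2 * C2 / η + 2 * (2 * P + η) := by positivity
      linarith
    have d2 : 2 * C2 / η ≤ D := by
      have : 0 ≤ 1 + K1 / lam / η + 2 * (2 * P + η) := by positivity
      linarith
    have d3 : 2 * (2 * P + η) ≤ D := by
      have : 0 ≤ 1 + K1 / lam / η + 2 * C2 / η := by positivity
      linarith
    have hDp : 0 < D := by linarith
    refine ⟨D⁻¹, by positivity, inv_le_one_of_one_le₀ hD1, ?_, ?_, ?_⟩
    · rw [inv_mul_le_iff₀ hDp]; rwa [div_le_iff₀ hη] at d1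
    · rw [inv_mul_le_iff₀ hDp]; rw [div_le_iff₀ hη] at d2; linarith
    · rw [inv_mul_le_iff₀ hDp]; linarith
  refine ⟨lam, hlam, h0, hh0, hh1, ?_⟩
  intro h hh hhh y z hy hz hy0 hz0
  have ex := est_x K hR hy hz hy0 hz0 hh (hhh.trans hh1)
  have ev := HV hy hz hy0 hz0 hh (hhh.trans hh1)
  rw [← hK1] at ex
  set b := ‖Lam lam (y 0) - Lam lam (z 0)‖ with hb
  set a := ‖y 0 - z 0‖ with ha
  set p := psi φ (y 0).1 with hp
  have hp0 : 0 ≤ p := psi_nonneg K _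
  have hpP : p ≤ P := psi_le K _
  have hb0 : 0 ≤ b := norm_nonneg _
  have bx : ‖(y 0).1 - (z 0).1‖ ≤ b := norm_fst_le (Lam lam (y 0) - Lam lam (z 0))
  have bv : lam * ‖(y 0).2 - (z 0).2‖ ≤ b := by
    have := norm_snd_le (Lam lam (y 0) - Lam lam (z 0))
    change ‖lam • (y 0).2 - lam • (z 0).2‖ ≤ b at this
    rwa [← smul_sub, norm_smul, Real.norm_of_nonneg hlam.le] at this
  have ab : lam * a ≤ b := by
    rw [← le_div_iff₀' hlam]
    refine norm_prod_le_iff.2 ⟨?_, ?_⟩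
    · rw [le_div_iff₀' hlam]
      change lam * ‖(y 0).1 - (z 0).1‖ ≤ b
      nlinarith [norm_nonneg ((y 0).1 - (z 0).1)]
    · rw [le_div_iff₀' hlam]; exact bv
  have hu : h * (2 * p + η) ≤ 1 / 2 := by
    refine le_trans ?_ hhe
    gcongr
  have key : ‖(Lam lam (Shr h (y h)) - Lam lam (Shr h (z h))) -
      (Lam lam (y 0) - Lam lam (z 0))‖ ≤ h * (2 * p + η) * b := by
    refine norm_prod_le_iff.2 ⟨?_, ?_⟩
    · refine (show ‖((y h).1 - h • (y h).2 - ((z h).1 - h • (z h).2)) - ((y 0).1 - (z 0).1)‖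
        ≤ _ from ex.trans ?_)
      have h1 : a ≤ b / lam := by rwa [le_div_iff₀' hlam]
      calc h * (K1 * a) * h ≤ h * (K1 * (b / lam)) * h0 := by gcongr
        _ = h * (h0 * (K1 / lam)) * b := by ring
        _ ≤ h * (2 * p + η) * b := by gcongr; linarith
    · change ‖(lam • (y h).2 - lam • (z h).2) - (lam • (y 0).2 - lam • (z 0).2)‖ ≤ _
      rw [← smul_sub, ← smul_sub, ← smul_sub, norm_smul, Real.norm_of_nonneg hlam.le]
      calc _ ≤ lam * ((2 * p * ‖(y 0).2 - (z 0).2‖ + 4 * l * R * ‖(y 0).1 - (z 0).1‖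
            + C2 * h * a) * h) := by gcongr
        _ = h * (2 * p * (lam * ‖(y 0).2 - (z 0).2‖) +
            (4 * l * R * lam) * ‖(y 0).1 - (z 0).1‖ + (h * C2) * (lam * a)) := by ring
        _ ≤ h * (2 * p * b + (η / 2) * b + (h0 * C2) * b) := by gcongr
        _ ≤ h * (2 * p * b + (η / 2) * b + (η / 2) * b) := by gcongr
        _ = _ := by ring
  set b' := ‖Lam lam (Shr h (y h)) - Lam lam (Shr h (z h))‖ with hb'
  have h5 : b - h * (2 * p + η) * b ≤ b' := by
    have := norm_sub_norm_le (Lam lam (y 0) - Lam lam (z 0))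
      (Lam lam (Shr h (y h)) - Lam lam (Shr h (z h)))
    have h7 := norm_sub_rev (Lam lam (y 0) - Lam lam (z 0))
      (Lam lam (Shr h (y h)) - Lam lam (Shr h (z h)))
    linarith
  set u := h * (2 * p + η) with hu'
  have hu0 : 0 ≤ u := by positivity
  have h6 : 1 ≤ Real.exp (2 * u) * (1 - u) := by
    have := Real.add_one_le_exp (2 * u)
    nlinarith
  calc b ≤ Real.exp (2 * u) * (1 - u) * b := by nlinarith
    _ = Real.exp (2 * u) * (b - u * b) := by ring
    _ ≤ _ := by gcongr
end

section
variable {n N : ℕ} {φ : EE n → ℝ} {B l : ℝ}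
variable {S : ℝ → XX n N × XX n N → XX n N × XX n N}

structure CSFlow (φ : EE n → ℝ) (S : ℝ → XX n N × XX n N → XX n N × XX n N) : Prop where
  zero : S 0 = id
  semi : ∀ s t : ℝ, 0 ≤ s → 0 ≤ t → S (s + t) = S s ∘ S t
  sol : ∀ d, IsSol φ (fun t => S t d)

/-- bounded velocity region -/
def Om (n N : ℕ) (R : ℝ) : Set (XX n N × XX n N) := {d | ‖d.2‖ ≤ R}

lemma CSFlow.maps (K : Ker n N φ B l) (f : CSFlow φ S) {R t : ℝ} (ht : 0 ≤ t)
    {d : XX n N × XX n N} (hd : d ∈ Om n N R) : S t d ∈ Om n N R := by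
  have := (f.sol d).vel K ht
  simp only [f.zero, id] at this
  exact this.trans hd

lemma CSFlow.gron (K : Ker n N φ B l) (f : CSFlow φ S) {R t : ℝ} (hR : 0 ≤ R) (ht : 0 ≤ t)
    {d e : XX n N × XX n N} (hd : d ∈ Om n N R) (he : e ∈ Om n N R) :
    ‖S t d - S t e‖ ≤ ‖d - e‖ * Real.exp (KK N B l R * t) := by
  have := _root_.gron K hR (f.sol d) (f.sol e) (by simp only [f.zero]; exact hd)
    (by simp only [f.zero]; exact he) ht
  simpa [f.zero] using this

lemma CSFlow.cont (K : Ker n N φ B l) (f : CSFlow φ S) {t : ℝ} (ht : 0 ≤ t) : Continuous (S t) := by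
  rw [continuous_iff_continuousAt]
  intro d
  have hR : (0 : ℝ) ≤ ‖d‖ + 1 := by positivity
  have hL : LipschitzOnWith (Real.exp (KK N B l (‖d‖ + 1) * t)).toNNReal (S t)
      (Om n N (‖d‖ + 1)) := by
    refine LipschitzOnWith.of_dist_le_mul fun u hu w hw => ?_
    rw [dist_eq_norm, dist_eq_norm, Real.coe_toNNReal _ (by positivity), mul_comm]
    exact f.gron K hR ht hu hw
  refine hL.continuousOn.continuousAt ?_
  have : IsOpen {e : XX n N × XX n N | ‖e.2‖ < ‖d‖ + 1} :=
    isOpen_lt (by fun_prop) continuous_const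
  refine mem_of_superset (this.mem_nhds ?_) fun e he => (le_of_lt he : ‖e.2‖ ≤ ‖d‖ + 1)
  have := norm_snd_le d
  change ‖d.2‖ < ‖d‖ + 1
  linarith

lemma CSFlow.uniq (K : Ker n N φ B l) (f : CSFlow φ S) {y : ℝ → XX n N × XX n N} (hy : IsSol φ y)
    {t : ℝ} (ht : 0 ≤ t) : S t (y 0) = y t := by
  have := _root_.gron K (norm_nonneg (y 0).2) (f.sol (y 0)) hy (by simp [f.zero])
    le_rfl ht
  simp only [f.zero, id, sub_self, norm_zero, zero_mul] at this
  exact sub_eq_zero.1 (norm_le_zero_iff.1 this)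

/-- lattice translation -/
noncomputable def lat (k : Fin N → Fin n → ℤ) : XX n N × XX n N := (fun i => latticePoint (k i), 0)

lemma latticePoint_sub (k k' : Fin n → ℤ) :
    latticePoint (k - k') = latticePoint k - latticePoint k' := by
  ext a
  simp [latticePoint, mul_sub]

lemma lat_sub (k k' : Fin N → Fin n → ℤ) :
    (lat (k - k') : XX n N × XX n N) = lat k - lat k' := by
  refine Prod.ext ?_ (by simp [lat])
  funext i
  exact latticePoint_sub _ _

lemma phi_lat (K : Ker n N φ B l) (x : XX n N) (k : Fin N → Fin n → ℤ) (i j : Fin N) :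
    φ ((x + (lat k).1) i - (x + (lat k).1) j) = φ (x i - x j) := by
  rw [← K.per (x i - x j) (k i - k j), latticePoint_sub]
  congr 1
  simp only [lat, Pi.add_apply]
  abel

lemma psi_lat (K : Ker n N φ B l) (x : XX n N) (k : Fin N → Fin n → ℤ) :
    psi φ (x + (lat k).1) = psi φ x := by
  unfold psi
  simp_rw [phi_lat K]

lemma acc_lat (K : Ker n N φ B l) (x v : XX n N) (k : Fin N → Fin n → ℤ) :
    acc φ (x + (lat k).1) v = acc φ x v := by
  unfold acc
  simp_rw [phi_lat K]

lemma CSFlow.equiv (K : Ker n N φ B l) (f : CSFlow φ S) {t : ℝ} (ht : 0 ≤ t)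
    (d : XX n N × XX n N) (k : Fin N → Fin n → ℤ) : S t (d + lat k) = S t d + lat k := by
  have hy : IsSol φ (fun t => S t d + lat k) := by
    intro s hs
    have := (f.sol d s hs).add_const (lat k)
    convert! this using 2
    · simp [lat]
    · have : (S s d + lat k).2 = (S s d).2 := by simp [lat]
      rw [this]
      exact acc_lat K _ _ k
  have := f.uniq K hy ht
  simpa [f.zero] using this

lemma vol_haar (n N : ℕ) : (volume : Measure (XX n N × XX n N)).IsAddHaarMeasure := by
  have h1 : (volume : Measure (XX n N)).IsAddHaarMeasure :=
    (inferInstance : (Measure.pi fun _ : Fin N => (volume : Measure (EE n))).IsAddHaarMeasure)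
  exact Measure.prod.instIsAddHaarMeasure (volume : Measure (XX n N)) (volume : Measure (XX n N))

lemma CSFlow.step (K : Ker n N φ B l) (f : CSFlow φ S) {R : ℝ} (hR : 0 ≤ R) {η : ℝ} (hη : 0 < η) :
    ∃ h0 : ℝ, 0 < h0 ∧ ∀ h : ℝ, 0 ≤ h → h ≤ h0 → InjOn (S h) (Om n N R) ∧
    ∀ (p : ℝ) (A : Set (XX n N × XX n N)), A ⊆ Om n N R → (∀ d ∈ A, psi φ d.1 ≤ p) →
      volume A ≤ ENNReal.ofReal (Real.exp (2 * (h * (2 * p + η))) ^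
        Module.finrank ℝ (XX n N × XX n N)) * volume (S h '' A) := by
  have := vol_haar n N
  obtain ⟨lam, hlam, h0, hh0, -, H⟩ := lam_est K hR hη
  refine ⟨h0, hh0, fun h hh hhh => ?_⟩
  have H' : ∀ d ∈ Om n N R, ∀ e ∈ Om n N R,
      ‖Lam lam d - Lam lam e‖ ≤ Real.exp (2 * (h * (2 * psi φ d.1 + η))) *
      ‖Lam lam (Shr h (S h d)) - Lam lam (Shr h (S h e))‖ := by
    intro d hd e he
    have := H h hh hhh (f.sol d) (f.sol e) (by simp only [f.zero]; exact hd)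
      (by simp only [f.zero]; exact he)
    simpa [f.zero] using this
  have hdet := Lam_det_ne (n := n) (N := N) hlam
  have hvol : ∀ A : Set (XX n N × XX n N), volume (Lam lam '' A) =
      ENNReal.ofReal |LinearMap.det (Lam lam : (XX n N × XX n N) →ₗ[ℝ] _)| * volume A :=
    fun A => Measure.addHaar_image_linearMap _ _ _
  have hvol2 : ∀ A : Set (XX n N × XX n N), volume (Shr h '' A) = volume A := by
    intro A
    rw [Measure.addHaar_image_linearMap, Shr_det]; simp
  refine ⟨?_, ?_⟩
  · intro d hd e he hde
    have := H' d hd e he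
    rw [hde, sub_self, norm_zero, mul_zero, norm_le_zero_iff, sub_eq_zero] at this
    have h3 : (Lam lam d).1 = (Lam lam e).1 := by rw [this]
    refine Prod.ext h3 ?_
    have h2 : lam • d.2 = lam • e.2 := congrArg (fun w : XX n N × XX n N => w.2) this
    exact smul_right_injective _ hlam.ne' h2
  · intro p A hA hp
    have := vol_comp (volume : Measure (XX n N × XX n N)) (fun d => Lam lam d)
      (fun d => Lam lam (Shr h (S h d))) A (Real.exp (2 * (h * (2 * p + η)))) (by positivity) ?_
    · have e : (fun d => Lam lam (Shr h (S h d))) '' A = Lam lam '' (Shr h '' (S h '' A)) := by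
        rw [image_image, image_image]
      rw [e, hvol, hvol, hvol2, mul_left_comm] at this
      exact (ENNReal.mul_le_mul_iff_right (by simpa using hdet) (by simp)).1 this
    · intro d hd e he
      refine (H' d (hA hd) e (hA he)).trans ?_
      have := hp d hd
      gcongr

lemma CSFlow.add_apply (f : CSFlow φ S) {s t : ℝ} (hs : 0 ≤ s) (ht : 0 ≤ t) (d : XX n N × XX n N) :
    S (s + t) d = S s (S t d) := by rw [f.semi s t hs ht]; rfl

lemma CSFlow.inj (K : Ker n N φ B l) (f : CSFlow φ S) {R : ℝ} (hR : 0 ≤ R) {t : ℝ} (ht : 0 ≤ t) :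
    InjOn (S t) (Om n N R) := by
  obtain ⟨h0, hh0, H⟩ := f.step K hR one_pos
  obtain ⟨m, hm⟩ := exists_nat_gt (t / h0)
  have hm0 : (0 : ℝ) < m := lt_of_le_of_lt (by positivity) hm
  have hh : 0 ≤ t / m := by positivity
  have hle : t / m ≤ h0 := by
    rw [div_lt_iff₀ hh0] at hm
    rw [div_le_iff₀ hm0]; linarith
  have h1 := (H (t / m) hh hle).1
  have h2 : ∀ j : ℕ, InjOn (S (j * (t / m))) (Om n N R) := by
    intro j
    induction j with
    | zero => simp [f.zero, injOn_id]
    | succ j ih =>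
      have : ((j + 1 : ℕ) : ℝ) * (t / m) = j * (t / m) + t / m := by push_cast; ring
      rw [this, f.semi _ _ (by positivity) hh]
      exact ih.comp h1 fun d hd => f.maps K hh hd
  have h3 := h2 m
  rwa [mul_div_cancel₀ t hm0.ne'] at h3

lemma CSFlow.iter (K : Ker n N φ B l) (f : CSFlow φ S) {R : ℝ} {η h : ℝ} (hh : 0 ≤ h)
    (H : ∀ (p : ℝ) (A : Set (XX n N × XX n N)), A ⊆ Om n N R → (∀ d ∈ A, psi φ d.1 ≤ p) →
      volume A ≤ ENNReal.ofReal (Real.exp (2 * (h * (2 * p + η))) ^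
        Module.finrank ℝ (XX n N × XX n N)) * volume (S h '' A)) (p : ℕ → ℝ) (m : ℕ) :
    ∀ (A : Set (XX n N × XX n N)), A ⊆ Om n N R →
      (∀ d ∈ A, ∀ k < m, psi φ (S (k * h) d).1 ≤ p k) →
      volume A ≤ ENNReal.ofReal (Real.exp (∑ k ∈ Finset.range m, 2 * (h * (2 * p k + η))) ^
        Module.finrank ℝ (XX n N × XX n N)) * volume (S (m * h) '' A) := by
  induction m with
  | zero => intro A _ _; simp [f.zero]
  | succ m ih =>
    intro A hA hp
    have h1 := ih A hA fun d hd k hk => hp d hd k (by omega)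
    have h2 := H (p m) (S (m * h) '' A) (by
        rintro _ ⟨d, hd, rfl⟩; exact f.maps K (by positivity) (hA hd)) (by
        rintro _ ⟨d, hd, rfl⟩; exact hp d hd m (by omega))
    have e : S ((m + 1 : ℕ) * h) '' A = S h '' (S (m * h) '' A) := by
      rw [image_image]
      have : ((m + 1 : ℕ) : ℝ) * h = h + m * h := by push_cast; ring
      rw [this, f.semi _ _ hh (by positivity)]; rfl
    rw [e, Finset.sum_range_succ, Real.exp_add, mul_pow, ENNReal.ofReal_mul (by positivity),
      mul_assoc]
    exact h1.trans (by gcongr)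
end

section
variable {n N : ℕ} {φ : EE n → ℝ} {B l : ℝ}
variable {S : ℝ → XX n N × XX n N → XX n N × XX n N}

lemma lint_steps (f : ℝ → ℝ) (a h M : ℝ) (ha : 0 ≤ a) (hh : 0 ≤ h) (hM : 0 ≤ M) (s : Finset ℕ)
    (c : ℕ → ℝ) (H : ∀ k ∈ s, ∀ t ∈ Ioc (a + k * h) (a + (k + 1) * h), c k ≤ f t)
    (hf : ∫⁻ t in Ioi 0, ENNReal.ofReal (f t) ≤ ENNReal.ofReal M) :
    ∑ k ∈ s, c k * h ≤ M := by
  have h1 : ∑ k ∈ s, ENNReal.ofReal (c k) * ENNReal.ofReal h ≤ ENNReal.ofReal M := by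
    refine le_trans ?_ hf
    calc ∑ k ∈ s, ENNReal.ofReal (c k) * ENNReal.ofReal h
        = ∑ k ∈ s, ∫⁻ t in Ioc (a + k * h) (a + (k + 1) * h), ENNReal.ofReal (c k) := by
          refine Finset.sum_congr rfl fun k _ => ?_
          rw [setLIntegral_const, Real.volume_Ioc]
          congr 2; ring
      _ ≤ ∑ k ∈ s, ∫⁻ t in Ioc (a + k * h) (a + (k + 1) * h), ENNReal.ofReal (f t) := by
          refine Finset.sum_le_sum fun k hk => ?_
          exact setLIntegral_mono' measurableSet_Ioc fun t ht =>
            ENNReal.ofReal_le_ofReal (H k hk t ht)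
      _ = ∫⁻ t in ⋃ k ∈ s, Ioc (a + k * h) (a + (k + 1) * h), ENNReal.ofReal (f t) := by
          rw [lintegral_biUnion_finset]
          · intro i _ j _ hij
            rw [Function.onFun, Set.disjoint_left]
            rintro t ⟨h1, h2⟩ ⟨h3, h4⟩
            rcases lt_or_gt_of_ne hij with hlt | hlt
            · have : ((i : ℝ) + 1) ≤ j := by exact_mod_cast hlt
              nlinarith
            · have : ((j : ℝ) + 1) ≤ i := by exact_mod_cast hlt
              nlinarith
          · exact fun _ _ => measurableSet_Ioc
      _ ≤ _ := by
          refine lintegral_mono_set ?_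
          intro t ht
          simp only [mem_iUnion] at ht
          obtain ⟨k, _, hk⟩ := ht
          have : 0 ≤ a + k * h := by positivity
          exact lt_of_le_of_lt this hk.1
  have h2 : ∀ k, ENNReal.ofReal (c k) * ENNReal.ofReal h = ENNReal.ofReal (max (c k) 0 * h) := by
    intro k
    rw [ENNReal.ofReal_mul (le_max_right _ _)]
    congr 1
    rcases le_total (c k) 0 with h | h
    · rw [max_eq_right h, ENNReal.ofReal_of_nonpos h, ENNReal.ofReal_zero]
    · rw [max_eq_left h]
  simp_rw [h2] at h1
  rw [← ENNReal.ofReal_sum_of_nonneg (fun k _ => by positivity),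
    ENNReal.ofReal_le_ofReal_iff hM] at h1
  refine le_trans (Finset.sum_le_sum fun k _ => ?_) h1
  gcongr
  exact le_max_left _ _

lemma CSFlow.psi_step (K : Ker n N φ B l) (f : CSFlow φ S) {R : ℝ} {d : XX n N × XX n N}
    (hd : d ∈ Om n N R) {a h τ : ℝ} (ha : 0 ≤ a) (h1 : a ≤ τ) (h2 : τ ≤ a + h) (hR : 0 ≤ R) :
    psi φ (S a d).1 - N * (N * (2 * l)) * R * h ≤ psi φ (S τ d).1 := by
  have h3 := f.maps K ha hd
  have h4 := psi_move K (R := R) (f.sol (S a d)) (by simp only [f.zero]; exact h3)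
    (sub_nonneg.2 h1)
  simp only [f.zero, id] at h4
  rw [← f.add_apply (sub_nonneg.2 h1) ha, sub_add_cancel] at h4
  have h5 := abs_le.1 h4
  have hl := K.hl
  have h6 : N * (N * (2 * l)) * R * (τ - a) ≤ N * (N * (2 * l)) * R * h := by
    gcongr; linarith
  linarith [h5.1]

lemma psi_cont (K : Ker n N φ B l) : Continuous (fun x : XX n N => psi φ x) := by
  have hl := K.hl
  have : LipschitzWith (N * (N * (2 * l))).toNNReal (fun x : XX n N => psi φ x) := by
    refine LipschitzWith.of_dist_le_mul fun x y => ?_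
    rw [Real.dist_eq, dist_eq_norm, Real.coe_toNNReal _ (by positivity)]
    exact psi_lip K x y
  exact this.continuous

lemma CSFlow.meas_image (K : Ker n N φ B l) (f : CSFlow φ S) {R : ℝ} (hR : 0 ≤ R) {t : ℝ}
    (ht : 0 ≤ t) {A : Set (XX n N × XX n N)} (hA : MeasurableSet A) (hAO : A ⊆ Om n N R) :
    MeasurableSet (S t '' A) :=
  hA.image_of_continuousOn_injOn (f.cont K ht).continuousOn ((f.inj K hR ht).mono hAO)

lemma CSFlow.vol_bound (K : Ker n N φ B l) (f : CSFlow φ S) {R M : ℝ} (hR : 0 ≤ R) (hM : 0 ≤ M)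
    {A : Set (XX n N × XX n N)} (hA : MeasurableSet A) (hAO : A ⊆ Om n N R)
    (hint : ∀ d ∈ A, ∫⁻ s in Ioi (0 : ℝ), ENNReal.ofReal (psi φ (S s d).1) ≤ ENNReal.ofReal M)
    {t : ℝ} (ht : 0 ≤ t) :
    volume A ≤ ENNReal.ofReal (Real.exp (2 * (2 * (M + 2) + 1)) ^
        Module.finrank ℝ (XX n N × XX n N)) * volume (S t '' A) := by
  have hl := K.hl
  set η : ℝ := 1 / (t + 1) with hηd
  have hη : 0 < η := by positivity
  have htη : t * η ≤ 1 := by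
    rw [hηd, mul_one_div, div_le_one (by positivity)]; linarith
  obtain ⟨h0, hh0, H⟩ := f.step K hR hη
  set Q : ℝ := N * (N * (2 * l)) * R with hQ
  have hQ0 : 0 ≤ Q := by positivity
  obtain ⟨m, hm⟩ := exists_nat_gt (max (t / h0) (Q * t / η))
  have hm1 := (le_max_left _ _).trans_lt hm
  have hm2 := (le_max_right _ _).trans_lt hm
  have hm0 : (0 : ℝ) < m := lt_of_le_of_lt (by positivity) hm1
  set h := t / m with hhd
  have hh : 0 ≤ h := by positivity
  have hmh : m * h = t := mul_div_cancel₀ t hm0.ne'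
  have hle : h ≤ h0 := by
    rw [div_lt_iff₀ hh0] at hm1
    rw [hhd, div_le_iff₀ hm0]; linarith
  have hQh : Q * h ≤ η := by
    rw [div_lt_iff₀ hη] at hm2
    rw [hhd, ← mul_div_assoc, div_le_iff₀ hm0]; linarith
  obtain ⟨-, H1⟩ := H h hh hle
  have hkh : ∀ k : ℕ, 0 ≤ k * h := fun k => by positivity
  let q : XX n N × XX n N → (Fin m → ℕ) := fun d k => ⌊psi φ (S ((k : ℕ) * h) d).1 / η⌋₊
  have hq : Measurable q := by
    refine measurable_pi_lambda _ fun k => ?_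
    refine Nat.measurable_floor.comp ?_
    have : Continuous fun d => psi φ (S ((k : ℕ) * h) d).1 / η :=
      ((psi_cont K).comp (continuous_fst.comp (f.cont K (hkh k)))).div_const _
    exact this.measurable
  let cell : (Fin m → ℕ) → Set (XX n N × XX n N) := fun c => A ∩ q ⁻¹' {c}
  have hcm : ∀ c, MeasurableSet (cell c) := fun c => hA.inter (hq (measurableSet_singleton c))
  have hU : ⋃ c, cell c = A := by
    ext d
    simp [cell]
  have hUi : S t '' A = ⋃ c, S t '' cell c := by rw [← image_iUnion, hU]
  have hdisj : Pairwise (Function.onFun Disjoint fun c => S t '' cell c) := by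
    intro c c' hcc
    rw [Function.onFun, Set.disjoint_left]
    rintro _ ⟨d, hd, rfl⟩ ⟨e, he, hde⟩
    have : e = d := f.inj K hR ht (hAO he.1) (hAO hd.1) hde
    subst this
    exact hcc (hd.2.symm.trans he.2)
  have hcell : ∀ c, volume (cell c) ≤ ENNReal.ofReal (Real.exp (2 * (2 * (M + 2) + 1)) ^
        Module.finrank ℝ (XX n N × XX n N)) * volume (S t '' cell c) := by
    intro c
    rcases (cell c).eq_empty_or_nonempty with he | ⟨d, hd⟩
    · simp [he]
    let p : ℕ → ℝ := fun k => if hk : k < m then η * (c ⟨k, hk⟩ + 1) else 0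
    have key := f.iter K hh H1 p m (cell c) (fun d hd => hAO hd.1) (by
      intro e he k hk
      simp only [p, hk, dif_pos]
      have h1 : ⌊psi φ (S (k * h) e).1 / η⌋₊ = c ⟨k, hk⟩ := congrFun he.2 ⟨k, hk⟩
      have h2 := Nat.lt_floor_add_one (psi φ (S (k * h) e).1 / η)
      rw [h1, div_lt_iff₀ hη] at h2
      linarith)
    rw [hmh] at key
    refine key.trans ?_
    have hp : ∀ k < m, p k ≤ psi φ (S (k * h) d).1 + η := by
      intro k hk
      simp only [p, hk, dif_pos]
      have h1 : ⌊psi φ (S (k * h) d).1 / η⌋₊ = c ⟨k, hk⟩ := congrFun hd.2 ⟨k, hk⟩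
      have h2 := Nat.floor_le (div_nonneg (psi_nonneg K (S (k * h) d).1) hη.le)
      rw [h1, le_div_iff₀ hη] at h2
      linarith
    have h3 := lint_steps (fun s => psi φ (S s d).1) 0 h M le_rfl hh hM (Finset.range m)
      (fun k => psi φ (S (k * h) d).1 - η) (by
        intro k _ τ hτ
        rw [zero_add, zero_add] at hτ
        have := f.psi_step K (hAO hd.1) (hkh k) hτ.1.le (h := h) (by linarith [hτ.2]) hR
        linarith) (hint d hd.1)
    have hsum : ∑ k ∈ Finset.range m, 2 * (h * (2 * p k + η)) ≤ 2 * (2 * (M + 2) + 1) := by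
      calc _ ≤ ∑ k ∈ Finset.range m, (4 * ((psi φ (S (k * h) d).1 - η) * h) + 10 * (h * η)) := by
            refine Finset.sum_le_sum fun k hk => ?_
            have := mul_le_mul_of_nonneg_left (hp k (Finset.mem_range.1 hk)) hh
            linarith
        _ = 4 * ∑ k ∈ Finset.range m, (psi φ (S (k * h) d).1 - η) * h + 10 * (m * h * η) := by
            rw [Finset.sum_add_distrib, ← Finset.mul_sum]; simp; ring
        _ ≤ _ := by rw [hmh]; linarith
    gcongr
  calc volume A = volume (⋃ c, cell c) := by rw [hU]
    _ ≤ ∑' c, volume (cell c) := measure_iUnion_le _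
    _ ≤ ∑' c, ENNReal.ofReal (Real.exp (2 * (2 * (M + 2) + 1)) ^
        Module.finrank ℝ (XX n N × XX n N)) * volume (S t '' cell c) := ENNReal.tsum_le_tsum hcell
    _ = _ := by
      rw [ENNReal.tsum_mul_left, hUi, measure_iUnion hdisj]
      exact fun c => f.meas_image K hR ht (hcm c) fun d hd => hAO hd.1
end

section
variable {n N : ℕ} {φ : EE n → ℝ} {B l : ℝ}
variable {S : ℝ → XX n N × XX n N → XX n N × XX n N}

/-- a set of infinitely often visited points is nonempty -/
lemma exists_inf_mem {E : Type*} [MeasurableSpace E] (μ : Measure E) (D : ℕ → Set E) (C : Set E)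
    (hD : ∀ k, MeasurableSet (D k)) (hDC : ∀ k, D k ⊆ C) (hC : μ C ≠ ⊤) (c : ENNReal)
    (hc : c ≠ 0) (h : ∀ k, c ≤ μ (D k)) : ∃ y, {k | y ∈ D k}.Infinite := by
  let U : ℕ → Set E := fun j => ⋃ k ∈ Ici j, D k
  have hU : Antitone U := by
    intro i j hij
    exact biUnion_subset_biUnion_left fun k (hk : j ≤ k) => hij.trans hk
  have h1 : μ (⋂ j, U j) = ⨅ j, μ (U j) := by
    refine hU.measure_iInter (fun j => ?_) ⟨0, ?_⟩
    · exact (MeasurableSet.biUnion (to_countable _) fun k _ => hD k).nullMeasurableSet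
    · refine ne_top_of_le_ne_top hC (measure_mono ?_)
      exact iUnion₂_subset fun k _ => hDC k
  have h2 : c ≤ μ (⋂ j, U j) := by
    rw [h1]
    refine le_iInf fun j => (h j).trans (measure_mono ?_)
    exact subset_biUnion_of_mem (u := D) (mem_Ici.2 (le_refl j))
  have h3 : (⋂ j, U j).Nonempty := by
    by_contra hne
    rw [not_nonempty_iff_eq_empty] at hne
    rw [hne, measure_empty] at h2
    exact hc (le_antisymm h2 (zero_le))
  obtain ⟨y, hy⟩ := h3
  refine ⟨y, ?_⟩
  rw [Set.infinite_iff_exists_gt]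
  intro a
  have := mem_iInter.1 hy (a + 1)
  simp only [U, mem_iUnion] at this
  obtain ⟨k, hk, hyk⟩ := this
  exact ⟨k, hyk, hk⟩

/-- fundamental cell with bounded velocities -/
def Cel (n N : ℕ) (R : ℝ) : Set (XX n N × XX n N) :=
  {d | (∀ i a, d.1 i a ∈ Ico (0 : ℝ) (2 * Real.pi)) ∧ ‖d.2‖ ≤ R}

lemma Cel_meas (R : ℝ) : MeasurableSet (Cel n N R) := by
  have h1 : ∀ i a, MeasurableSet {d : XX n N × XX n N | d.1 i a ∈ Ico (0 : ℝ) (2 * Real.pi)} := by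
    intro i a
    have hc : Continuous fun d : XX n N × XX n N => d.1 i a := by fun_prop
    exact hc.measurable measurableSet_Ico
  have h2 : MeasurableSet {d : XX n N × XX n N | ‖d.2‖ ≤ R} :=
    (isClosed_le (by fun_prop) continuous_const).measurableSet
  have : Cel n N R = (⋂ i, ⋂ a, {d : XX n N × XX n N | d.1 i a ∈ Ico (0 : ℝ) (2 * Real.pi)}) ∩
      {d : XX n N × XX n N | ‖d.2‖ ≤ R} := by
    ext d; simp [Cel]
  rw [this]
  exact (MeasurableSet.iInter fun i => MeasurableSet.iInter fun a => h1 i a).inter h2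

lemma euclid_bd (z : EE n) (c : ℝ) (hz : ∀ a, |z a| ≤ c) : ‖z‖ ≤ Real.sqrt (n * c ^ 2) := by
  rw [EuclideanSpace.norm_eq]
  refine Real.sqrt_le_sqrt ?_
  calc ∑ a, ‖z a‖ ^ 2 ≤ ∑ a : Fin n, c ^ 2 := by
        refine Finset.sum_le_sum fun a _ => ?_
        have := hz a
        rw [Real.norm_eq_abs]
        gcongr
    _ = n * c ^ 2 := by simp

lemma Cel_fin (R : ℝ) : volume (Cel n N R) ≠ ⊤ := by
  have := vol_haar n N
  refine ne_top_of_le_ne_top (b := volume (Metric.closedBall (0 : XX n N × XX n N)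
    (max (Real.sqrt (n * (2 * Real.pi) ^ 2)) R))) ?_ (measure_mono ?_)
  · exact (isCompact_closedBall _ _).measure_lt_top.ne
  · intro d hd
    rw [mem_closedBall_zero_iff, Prod.norm_def]
    refine max_le_max ?_ hd.2
    rw [pi_norm_le_iff_of_nonneg (by positivity)]
    intro i
    refine euclid_bd _ _ fun a => ?_
    have := hd.1 i a
    rw [abs_of_nonneg this.1]
    exact this.2.le

lemma lat_apply (k : Fin N → Fin n → ℤ) (i : Fin N) (a : Fin n) :
    (lat k : XX n N × XX n N).1 i a = 2 * Real.pi * k i a := by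
  simp [lat, latticePoint]

lemma lat_snd (k : Fin N → Fin n → ℤ) : (lat k : XX n N × XX n N).2 = 0 := rfl

lemma add_lat_Om {R : ℝ} {d : XX n N × XX n N} (k : Fin N → Fin n → ℤ) (hd : d ∈ Om n N R) :
    d + lat k ∈ Om n N R := by
  change ‖d.2 + 0‖ ≤ R
  rw [add_zero]; exact hd

lemma frac_mem (x : ℝ) : x - 2 * Real.pi * ⌊x / (2 * Real.pi)⌋ ∈ Ico (0 : ℝ) (2 * Real.pi) := by
  have hpi := Real.pi_pos
  have h1 := Int.floor_le (x / (2 * Real.pi))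
  have h2 := Int.lt_floor_add_one (x / (2 * Real.pi))
  rw [le_div_iff₀ (by positivity)] at h1
  rw [div_lt_iff₀ (by positivity)] at h2
  constructor <;> linarith

lemma exists_cell {R : ℝ} {d : XX n N × XX n N} (hd : d ∈ Om n N R) :
    ∃ k : Fin N → Fin n → ℤ, d - lat k ∈ Cel n N R := by
  refine ⟨fun i a => ⌊d.1 i a / (2 * Real.pi)⌋, fun i a => ?_, ?_⟩
  · have : (d - lat fun i a => ⌊d.1 i a / (2 * Real.pi)⌋).1 i a =
        d.1 i a - 2 * Real.pi * ⌊d.1 i a / (2 * Real.pi)⌋ := by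
      rw [← lat_apply (fun i a => ⌊d.1 i a / (2 * Real.pi)⌋)]; rfl
    rw [this]
    exact frac_mem _
  · change ‖d.2 - 0‖ ≤ R
    rw [sub_zero]; exact hd

lemma fold_vol {R : ℝ} {E : Set (XX n N × XX n N)} (hE : MeasurableSet E) (hEO : E ⊆ Om n N R)
    (hinj : ∀ (y : XX n N × XX n N) (k k' : Fin N → Fin n → ℤ),
      y + lat k ∈ E → y + lat k' ∈ E → k = k') :
    volume E ≤ volume (⋃ k : Fin N → Fin n → ℤ, Cel n N R ∩ (fun y => y + lat k) ⁻¹' E) := by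
  have := vol_haar n N
  have hm : ∀ k : Fin N → Fin n → ℤ,
      MeasurableSet (Cel n N R ∩ (fun y : XX n N × XX n N => y + lat k) ⁻¹' E) := fun k =>
    (Cel_meas R).inter (hE.preimage (by fun_prop))
  rw [measure_iUnion _ hm]
  · have h1 : E ⊆ ⋃ k : Fin N → Fin n → ℤ,
        (fun y => y + lat (-k)) ⁻¹' (Cel n N R ∩ (fun y => y + lat k) ⁻¹' E) := by
      intro d hd
      obtain ⟨k, hk⟩ := exists_cell (hEO hd)
      have e0 : (lat (-k) : XX n N × XX n N) = - lat k := by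
        have h0 : (lat 0 : XX n N × XX n N) = 0 := by
          simpa using lat_sub (n := n) (N := N) 0 0
        have := lat_sub (n := n) (N := N) 0 k
        rwa [h0, zero_sub, zero_sub] at this
      refine mem_iUnion.2 ⟨k, ?_, ?_⟩
      · change d + lat (-k) ∈ _
        rwa [e0, ← sub_eq_add_neg]
      · change d + lat (-k) + lat k ∈ E
        rwa [e0, neg_add_cancel_right]
    refine (measure_mono h1).trans ((measure_iUnion_le _).trans_eq ?_)
    refine tsum_congr fun k => ?_
    exact measure_preimage_add_right _ _ _
  · intro k k' hkk
    rw [Function.onFun, Set.disjoint_left]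
    rintro y ⟨_, h1⟩ ⟨_, h2⟩
    exact hkk (hinj y k k' h1 h2)

lemma cell_uniq {x y : XX n N × XX n N} (k : Fin N → Fin n → ℤ)
    (hx : ∀ i a, x.1 i a ∈ Ico (0 : ℝ) (2 * Real.pi))
    (hy : ∀ i a, y.1 i a ∈ Ico (0 : ℝ) (2 * Real.pi)) (h : y = x + lat k) : k = 0 := by
  funext i a
  have h1 : y.1 i a = x.1 i a + 2 * Real.pi * k i a := by
    rw [h, ← lat_apply k]; rfl
  have h2 := hx i a
  have h3 := hy i a
  have hpi := Real.pi_pos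
  rw [h1] at h3
  have h4 : (k i a : ℝ) < 1 := by
    by_contra hc
    push Not at hc
    nlinarith [h2.1, h3.2]
  have h5 : (-1 : ℝ) < k i a := by
    by_contra hc
    push Not at hc
    nlinarith [h2.2, h3.1]
  have h6 : k i a < 1 := by exact_mod_cast h4
  have h7 : -1 < k i a := by exact_mod_cast h5
  change k i a = 0
  omega

lemma CSFlow.null (K : Ker n N φ B l) (f : CSFlow φ S) {R M : ℝ} (hR : 0 ≤ R) (hM : 0 ≤ M)
    {F : Set (XX n N × XX n N)} (hF : MeasurableSet F) (hFO : F ⊆ Om n N R)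
    (hcell : ∀ d ∈ F, ∀ i a, d.1 i a ∈ Ico (0 : ℝ) (2 * Real.pi))
    (hint : ∀ d ∈ F, ∫⁻ s in Ioi (0 : ℝ), ENNReal.ofReal (psi φ (S s d).1) ≤ ENNReal.ofReal M)
    {t0 ε : ℝ} (ht0 : 0 ≤ t0) (hε : 0 < ε) :
    volume {d | d ∈ F ∧ 2 * ε ≤ psi φ (S t0 d).1} = 0 := by
  have hl := K.hl
  set G : Set (XX n N × XX n N) := {d | d ∈ F ∧ 2 * ε ≤ psi φ (S t0 d).1} with hG
  by_contra hne
  have hGm : MeasurableSet G := by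
    refine hF.inter ?_
    have : Continuous fun d => psi φ (S t0 d).1 :=
      (psi_cont K).comp (continuous_fst.comp (f.cont K ht0))
    exact (isClosed_le continuous_const this).measurableSet
  have hGF : G ⊆ F := fun d hd => hd.1
  have hGO : G ⊆ Om n N R := hGF.trans hFO
  set Q : ℝ := N * (N * (2 * l)) * R with hQ
  have hQ0 : 0 ≤ Q := by positivity
  set δ : ℝ := ε / (Q + 1) with hδd
  have hδ : 0 < δ := by positivity
  have hQδ : Q * δ ≤ ε := by
    rw [hδd, ← mul_div_assoc, div_le_iff₀ (by positivity)]
    nlinarith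
  have hkδ : ∀ k : ℕ, 0 ≤ k * δ := fun k => by positivity
  set C := ENNReal.ofReal (Real.exp (2 * (2 * (M + 2) + 1)) ^
        Module.finrank ℝ (XX n N × XX n N)) with hC
  have hC0 : C ≠ ⊤ := ENNReal.ofReal_ne_top
  let E : ℕ → Set (XX n N × XX n N) := fun k => S (k * δ) '' G
  have hEm : ∀ k, MeasurableSet (E k) := fun k => f.meas_image K hR (hkδ k) hGm hGO
  have hEO : ∀ k, E k ⊆ Om n N R := by
    rintro k _ ⟨d, hd, rfl⟩
    exact f.maps K (hkδ k) (hGO hd)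
  let D : ℕ → Set (XX n N × XX n N) := fun k =>
    ⋃ q : Fin N → Fin n → ℤ, Cel n N R ∩ (fun y => y + lat q) ⁻¹' E k
  have hDm : ∀ k, MeasurableSet (D k) := fun k =>
    MeasurableSet.iUnion fun q => (Cel_meas R).inter ((hEm k).preimage (by fun_prop))
  have hDC : ∀ k, D k ⊆ Cel n N R := fun k => iUnion_subset fun q => inter_subset_left
  have hinj : ∀ k (y : XX n N × XX n N) (q q' : Fin N → Fin n → ℤ),
      y + lat q ∈ E k → y + lat q' ∈ E k → q = q' := by
    rintro k y q q' ⟨g, hg, hgy⟩ ⟨g', hg', hgy'⟩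
    have h1 : S (k * δ) (g + lat (q' - q)) = S (k * δ) g' := by
      rw [f.equiv K (hkδ k), hgy, hgy', lat_sub]; abel
    have h2 := f.inj K hR (hkδ k) (add_lat_Om _ (hGO hg)) (hGO hg') h1
    have h3 := cell_uniq _ (hcell g (hGF hg)) (hcell g' (hGF hg')) h2.symm
    exact (sub_eq_zero.1 h3).symm
  have hDv : ∀ k, volume G / C ≤ volume (D k) := by
    intro k
    refine ENNReal.div_le_of_le_mul' ?_
    refine (f.vol_bound K hR hM hGm hGO (fun d hd => hint d (hGF hd)) (hkδ k)).trans ?_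
    exact mul_le_mul_right (fold_vol (hEm k) (hEO k) (hinj k)) _
  obtain ⟨y, hy⟩ := exists_inf_mem volume D (Cel n N R) hDm hDC (Cel_fin R) _
    (ENNReal.div_ne_zero.2 ⟨hne, hC0⟩) hDv
  obtain ⟨m, hm⟩ := exists_nat_gt (M / (ε * δ))
  obtain ⟨s, hs, hsc⟩ := hy.exists_subset_card_eq (m + 1)
  have hsne : s.Nonempty := Finset.card_pos.1 (by omega)
  have hks := s.max'_mem hsne
  have hkm : ∀ k ∈ s, k ≤ s.max' hsne := fun k hk => s.le_max' k hk
  generalize s.max' hsne = ks at hks hkm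
  obtain ⟨qs, -, gs, hgs, hys⟩ := mem_iUnion.1 (hs hks)
  have hgsO := hGO hgs
  have key : ∀ k ∈ s, 2 * ε ≤ psi φ (S (t0 + (ks - k : ℕ) * δ) gs).1 := by
    intro k hk
    obtain ⟨q, -, g, hg, hyq⟩ := mem_iUnion.1 (hs hk)
    have e1 : (ks : ℝ) * δ = k * δ + (ks - k : ℕ) * δ := by
      rw [Nat.cast_sub (hkm k hk)]; ring
    have h1 : S (k * δ) (g + lat (qs - q)) = S (k * δ) (S ((ks - k : ℕ) * δ) gs) := by
      rw [← f.add_apply (hkδ k) (hkδ _), ← e1, f.equiv K (hkδ k), hys, hyq, lat_sub]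
      dsimp only; abel
    have h2 := f.inj K hR (hkδ k) (add_lat_Om _ (hGO hg)) (f.maps K (hkδ _) hgsO) h1
    rw [f.add_apply ht0 (hkδ _), ← h2, f.equiv K ht0]
    have := psi_lat K (S t0 g).1 (qs - q)
    change 2 * ε ≤ psi φ ((S t0 g).1 + (lat (qs - q)).1)
    rw [this]
    exact hg.2
  have h3 := lint_steps (fun τ => psi φ (S τ gs).1) t0 δ M ht0 hδ.le hM
    (s.image fun k => ks - k) (fun _ => ε) (by
      intro j hj τ hτ
      obtain ⟨k, hk, rfl⟩ := Finset.mem_image.1 hj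
      have := f.psi_step K hgsO (add_nonneg ht0 (hkδ (ks - k))) hτ.1.le (h := δ)
        (by linarith [hτ.2]) hR
      have := key k hk
      linarith) (hint gs (hGF hgs))
  rw [Finset.sum_const, Finset.card_image_of_injOn, hsc, nsmul_eq_mul] at h3
  · rw [div_lt_iff₀ (by positivity)] at hm
    push_cast at h3
    nlinarith [mul_pos hε hδ]
  · intro a ha b hb hab
    have := hkm a ha
    have := hkm b hb
    dsimp only at hab
    omega
end

lemma exists_cell1 {n : ℕ} (z : EE n) : ∃ k : Fin n → ℤ,
    z + latticePoint k ∈ Metric.closedBall (0 : EE n) (Real.sqrt (n * (2 * Real.pi) ^ 2)) := by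
  refine ⟨fun a => -⌊z a / (2 * Real.pi)⌋, ?_⟩
  rw [mem_closedBall_zero_iff]
  refine euclid_bd _ _ fun a => ?_
  have h1 : (z + latticePoint fun a => -⌊z a / (2 * Real.pi)⌋) a =
      z a - 2 * Real.pi * ⌊z a / (2 * Real.pi)⌋ := by
    simp [latticePoint]; ring
  have := frac_mem (z a)
  rw [h1, abs_of_nonneg this.1]
  exact this.2.le

lemma exists_bd {n : ℕ} {E : Type*} [NormedAddCommGroup E] (g : EE n → E) (hg : Continuous g)
    (hper : ∀ z (k : Fin n → ℤ), g (z + latticePoint k) = g z) : ∃ B, 0 ≤ B ∧ ∀ z, ‖g z‖ ≤ B := by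
  obtain ⟨B, hB⟩ := (isCompact_closedBall (0 : EE n)
    (Real.sqrt (n * (2 * Real.pi) ^ 2))).exists_bound_of_continuousOn hg.continuousOn
  have h : ∀ z, ‖g z‖ ≤ B := by
    intro z
    obtain ⟨k, hk⟩ := exists_cell1 z
    rw [← hper z k]
    exact hB _ hk
  exact ⟨B, (norm_nonneg _).trans (h 0), h⟩

lemma exists_ker {n N : ℕ} (hN : 1 ≤ N) (φ : EE n → ℝ) (hφC1 : ContDiff ℝ 1 φ)
    (hφnonneg : ∀ z, 0 ≤ φ z) (hφper : ∀ z (k : Fin n → ℤ), φ (z + latticePoint k) = φ z) :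
    ∃ B l, Ker n N φ B l := by
  obtain ⟨B, hB, hB'⟩ := exists_bd φ hφC1.continuous hφper
  obtain ⟨l, hl, hl'⟩ := exists_bd (fderiv ℝ φ) (hφC1.continuous_fderiv (by norm_num)) (by
    intro z k
    rw [← fderiv_comp_add_right]
    congr 1
    funext w
    exact hφper w k)
  refine ⟨B, l, hN, hB, hl, hφnonneg, fun z => (le_abs_self _).trans (hB' z), ?_, hφper⟩
  intro z w
  exact Convex.norm_image_sub_le_of_norm_fderiv_le (s := univ)
    (fun x _ => (hφC1.differentiable (by norm_num)) x) (fun x _ => hl' x) convex_univ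
    (mem_univ w) (mem_univ z)

/-- **Lemma 3.3.** Let `S` be the solution flow of the periodic
Cucker–Smale system (in the periodic lift, with the torus identified with the
fundamental cell `[0,2π)^{nN}`). If on a measurable set `F` the velocities are bounded
by `R` and `∫_0^∞ Σ_{i≠j} φ_{ij} ds ≤ M` along every solution starting in `F`, then for
almost every initial datum in `F` the solution satisfies
`d_{𝕋^n}(x_i(t) − x_j(t)) ≥ r₀` for all `i ≠ j` and all `t ≥ 0`. -/
theorem stmt9 (n N : ℕ) (hn : 1 ≤ n) (hN : 1 ≤ N)
    (r₀ : ℝ) (hr₀ : 0 < r₀) (hr₀pi : r₀ < Real.pi)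
    (φ : EuclideanSpace ℝ (Fin n) → ℝ)
    (hφC1 : ContDiff ℝ 1 φ) (hφnonneg : ∀ z, 0 ≤ φ z)
    (hφper : ∀ z (k : Fin n → ℤ), φ (z + latticePoint k) = φ z)
    (hφsupp : ∀ z, 0 < φ z ↔ dTorus z < r₀)
    (S : ℝ → (Fin N → EuclideanSpace ℝ (Fin n)) × (Fin N → EuclideanSpace ℝ (Fin n)) →
      (Fin N → EuclideanSpace ℝ (Fin n)) × (Fin N → EuclideanSpace ℝ (Fin n)))
    (hS0 : S 0 = id)
    (hSsemi : ∀ s t : ℝ, 0 ≤ s → 0 ≤ t → S (s + t) = S s ∘ S t)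
    (hSx : ∀ d i, ∀ t ∈ Set.Ici (0 : ℝ),
      HasDerivWithinAt (fun τ => (S τ d).1 i) ((S t d).2 i) (Set.Ici 0) t)
    (hSv : ∀ d i, ∀ t ∈ Set.Ici (0 : ℝ),
      HasDerivWithinAt (fun τ => (S τ d).2 i)
        ((N : ℝ)⁻¹ • ∑ j, φ ((S t d).1 i - (S t d).1 j) •
          ((S t d).2 j - (S t d).2 i)) (Set.Ici 0) t)
    (F : Set ((Fin N → EuclideanSpace ℝ (Fin n)) × (Fin N → EuclideanSpace ℝ (Fin n))))
    (hFmeas : MeasurableSet F)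
    (hFcell : ∀ d ∈ F, ∀ i a, d.1 i a ∈ Set.Ico (0 : ℝ) (2 * Real.pi))
    (R : ℝ) (hR : 0 < R) (hFvel : ∀ d ∈ F, ∀ i, ‖d.2 i‖ ≤ R)
    (M : ℝ) (hM : 0 < M)
    (hFint : ∀ d ∈ F,
      ∫⁻ s in Set.Ioi (0 : ℝ),
        ENNReal.ofReal (∑ i, ∑ j ∈ Finset.univ.erase i, φ ((S s d).1 i - (S s d).1 j)) ≤
      ENNReal.ofReal M)
:
    ∀ᵐ d ∂(volume : Measure ((Fin N → EuclideanSpace ℝ (Fin n)) ×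
        (Fin N → EuclideanSpace ℝ (Fin n)))),
      d ∈ F → ∀ t ∈ Set.Ici (0 : ℝ), ∀ i j, i ≠ j →
        r₀ ≤ dTorus ((S t d).1 i - (S t d).1 j) := by
  obtain ⟨B, l, K⟩ := exists_ker (N := N) hN φ hφC1 hφnonneg hφper
  have f : CSFlow φ S := by
    refine ⟨hS0, hSsemi, fun d t ht => ?_⟩
    have h1 : HasDerivWithinAt (fun τ => (S τ d).1) (S t d).2 (Set.Ici 0) t :=
      hasDerivWithinAt_pi.2 fun i => hSx d i t ht
    have h2 : HasDerivWithinAt (fun τ => (S τ d).2) (acc φ (S t d).1 (S t d).2) (Set.Ici 0) t :=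
      hasDerivWithinAt_pi.2 fun i => hSv d i t ht
    exact h1.prodMk h2
  have hFO : F ⊆ Om n N R := fun d hd =>
    (pi_norm_le_iff_of_nonneg hR.le).2 (hFvel d hd)
  have hnull : ∀ (q : ℚ) (j : ℕ), 0 ≤ q →
      volume {d | d ∈ F ∧ 2 * (1 / ((j : ℝ) + 1)) ≤ psi φ (S q d).1} = 0 := fun q j hq =>
    f.null K hR.le hM.le hFmeas hFO hFcell hFint (by exact_mod_cast hq) (by positivity)
  have hae : ∀ᵐ d ∂(volume : Measure (XX n N × XX n N)), ∀ (q : ℚ) (j : ℕ), 0 ≤ q →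
      ¬ (d ∈ F ∧ 2 * (1 / ((j : ℝ) + 1)) ≤ psi φ (S q d).1) := by
    rw [ae_all_iff]; intro q
    rw [ae_all_iff]; intro j
    by_cases hq : 0 ≤ q
    · have := hnull q j hq
      filter_upwards [measure_eq_zero_iff_ae_notMem.1 this] with d hd _
      exact hd
    · exact Eventually.of_forall fun d h => absurd h hq
  filter_upwards [hae] with d hd hdF t ht i j hij
  by_contra hlt
  push Not at hlt
  have hpos := (hφsupp _).2 hlt
  have hpsi : 0 < psi φ (S t d).1 := by
    refine Finset.sum_pos' (fun _ _ => Finset.sum_nonneg fun _ _ => hφnonneg _)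
      ⟨i, Finset.mem_univ _, ?_⟩
    refine Finset.sum_pos' (fun _ _ => hφnonneg _) ⟨j, ?_, hpos⟩
    exact Finset.mem_erase.2 ⟨hij.symm, Finset.mem_univ _⟩
  have hmono : ∃ δ > 0, ∀ τ, t ≤ τ → τ ≤ t + δ → 0 < psi φ (S τ d).1 := by
    have hl := K.hl
    have hQ0 : 0 ≤ N * (N * (2 * l)) * R := by positivity
    set Q : ℝ := N * (N * (2 * l)) * R
    refine ⟨psi φ (S t d).1 / (Q + 1), by positivity, fun τ h1 h2 => ?_⟩
    refine lt_of_lt_of_le ?_ (f.psi_step K (hFO hdF) ht h1 h2 hR.le)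
    rw [sub_pos, ← mul_div_assoc, div_lt_iff₀ (by positivity)]
    change Q * _ < _
    linarith
  obtain ⟨δ, hδ, hτ⟩ := hmono
  obtain ⟨q, hq1, hq2⟩ := exists_rat_btwn (show t < t + δ by linarith)
  have hqp := hτ q hq1.le hq2.le
  obtain ⟨m, hm⟩ := exists_nat_one_div_lt (half_pos hqp)
  have ht' : (0 : ℝ) ≤ t := ht
  refine hd q m (by exact_mod_cast ht'.trans hq1.le) ⟨hdF, by linarith⟩
end

section
/- Let N = 2. For almost every initial datum (x₀, v₀) ∈ [0,2π)^{2n} × ℝ^{2n} (with respect to Lebesgue measure), the solution of the periodic two-agent Cucker–Smale system with that datum aligns: |v_1(t) − v_2(t)| → 0 as t → ∞. That is, the Generic Alignment Conjecture holds for N = 2. -/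
open Set MeasureTheory Filter

/-- The projection from `ℝ^n` to the unit torus. -/
noncomputable def torusProj (n : ℕ) (x : Fin n → ℝ) : UnitAddTorus (Fin n) :=
  Pi.map (fun _ => ((↑) : ℝ → UnitAddCircle)) x

lemma torusProj_quot (n : ℕ) : IsOpenQuotientMap (torusProj n) :=
  IsOpenQuotientMap.piMap (fun _ => QuotientAddGroup.isOpenQuotientMap_mk)

/-- The Haar probability measure on the torus. -/
noncomputable def torusMeas (n : ℕ) : Measure (UnitAddTorus (Fin n)) :=
  Measure.pi (fun _ => (AddCircle.haarAddCircle : Measure UnitAddCircle))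

instance (n : ℕ) : IsProbabilityMeasure (torusMeas n) := by
  unfold torusMeas; infer_instance

instance (n : ℕ) : Measure.IsOpenPosMeasure (torusMeas n) := by
  unfold torusMeas; infer_instance

lemma integral_mFourier {n : ℕ} (k : Fin n → ℤ) (hk : k ≠ 0) :
    ∫ x, UnitAddTorus.mFourier k x ∂(torusMeas n) = 0 := by
  obtain ⟨i, hi⟩ := Function.ne_iff.mp hk
  have h : ∫ x, UnitAddTorus.mFourier k x ∂(torusMeas n)
      = ∏ i, ∫ x, fourier (k i) x ∂(AddCircle.haarAddCircle : Measure UnitAddCircle) := by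
    unfold torusMeas UnitAddTorus.mFourier
    exact integral_fintype_prod_eq_prod (𝕜 := ℂ) (fun i (x : UnitAddCircle) => fourier (k i) x)
  rw [h]
  refine Finset.prod_eq_zero (Finset.mem_univ i) ?_
  exact integral_eq_zero_of_add_right_eq_neg (fourier_add_half_inv_index hi one_pos)

lemma mFourier_line {n : ℕ} (k : Fin n → ℤ) (x v : Fin n → ℝ) (s : ℝ) :
    UnitAddTorus.mFourier k (torusProj n (x + s • v)) =
      UnitAddTorus.mFourier k (torusProj n x) *
        Complex.exp ((2 * Real.pi * Complex.I * ((∑ a, (k a : ℝ) * v a : ℝ) : ℂ)) * s) := by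
  simp only [UnitAddTorus.mFourier, torusProj, ContinuousMap.coe_mk, Pi.map_apply, fourier_coe_apply,
    ← Complex.exp_sum, ← Complex.exp_add]
  congr 1
  push_cast
  rw [Finset.mul_sum, Finset.sum_mul, ← Finset.sum_add_distrib]
  refine Finset.sum_congr rfl fun a _ => ?_
  simp
  ring

lemma weyl_span {n : ℕ} (x v : Fin n → ℝ) (hv : ∀ k : Fin n → ℤ, k ≠ 0 → ∑ a, (k a : ℝ) * v a ≠ 0)
    (P : C(UnitAddTorus (Fin n), ℂ))
    (hP : P ∈ Submodule.span ℂ (Set.range (UnitAddTorus.mFourier (d := Fin n)))) :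
    ∃ C : ℝ, ∀ T : ℝ, ‖(∫ s in (0:ℝ)..T, P (torusProj n (x + s • v)))
      - T * ∫ y, P y ∂(torusMeas n)‖ ≤ C := by
  have hcl : ∀ Q : C(UnitAddTorus (Fin n), ℂ), Continuous fun s : ℝ => Q (torusProj n (x + s • v)) := by
    intro Q
    have := (torusProj_quot n).continuous
    fun_prop
  have hint : ∀ Q : C(UnitAddTorus (Fin n), ℂ), Integrable Q (torusMeas n) := fun Q =>
    Q.continuous.integrable_of_hasCompactSupport (HasCompactSupport.of_compactSpace _)
  induction hP using Submodule.span_induction with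
  | mem P h =>
    obtain ⟨k, rfl⟩ := h
    by_cases hk : k = 0
    · subst hk
      refine ⟨0, fun T => ?_⟩
      simp [UnitAddTorus.mFourier_zero]
    · rw [integral_mFourier k hk]
      simp only [mFourier_line, intervalIntegral.integral_const_mul]
      set l : ℂ := (2 * Real.pi * Complex.I * ((∑ a, (k a : ℝ) * v a : ℝ) : ℂ)) with hl
      have hl0 : l ≠ 0 := by
        have := hv k hk
        have h2 : ((∑ a, (k a : ℝ) * v a : ℝ) : ℂ) ≠ 0 := by exact_mod_cast this
        simp only [hl, ne_eq, mul_eq_zero, not_or]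
        refine ⟨⟨⟨two_ne_zero, by exact_mod_cast Real.pi_ne_zero⟩, Complex.I_ne_zero⟩, h2⟩
      refine ⟨‖UnitAddTorus.mFourier k (torusProj n x)‖ * (2 / ‖l‖), fun T => ?_⟩
      rw [integral_exp_mul_complex hl0, mul_zero, sub_zero, norm_mul, norm_div]
      gcongr
      refine (norm_sub_le _ _).trans ?_
      have : ‖Complex.exp (l * T)‖ = 1 := by
        rw [Complex.norm_exp]; simp [hl]
      rw [this]
      simp; norm_num
  | zero => exact ⟨0, fun T => by simp⟩
  | add P Q _ _ hP hQ =>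
    obtain ⟨C, hC⟩ := hP
    obtain ⟨D, hD⟩ := hQ
    refine ⟨C + D, fun T => ?_⟩
    have := (norm_add_le _ _).trans (add_le_add (hC T) (hD T))
    refine le_of_eq_of_le (congrArg norm ?_) this
    simp only [ContinuousMap.add_apply]
    rw [intervalIntegral.integral_add ((hcl P).intervalIntegrable _ _)
      ((hcl Q).intervalIntegrable _ _), integral_add (hint P) (hint Q)]
    ring
  | smul c P _ hP =>
    obtain ⟨C, hC⟩ := hP
    refine ⟨‖c‖ * C, fun T => ?_⟩
    have := mul_le_mul_of_nonneg_left (hC T) (norm_nonneg c)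
    rw [← norm_mul] at this
    refine le_of_eq_of_le (congrArg norm ?_) this
    simp only [ContinuousMap.smul_apply, smul_eq_mul]
    rw [intervalIntegral.integral_const_mul, integral_const_mul]
    ring

lemma weyl_unbounded {n : ℕ} (x v : Fin n → ℝ)
    (hv : ∀ k : Fin n → ℤ, k ≠ 0 → ∑ a, (k a : ℝ) * v a ≠ 0)
    (f : C(UnitAddTorus (Fin n), ℝ)) (hf : ∀ y, 0 ≤ f y) (y₀) (hf0 : f y₀ ≠ 0) :
    Tendsto (fun T : ℝ => ∫ s in (0:ℝ)..T, f (torusProj n (x + s • v))) atTop atTop := by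
  have hcl : ∀ Q : C(UnitAddTorus (Fin n), ℂ), Continuous fun s : ℝ => Q (torusProj n (x + s • v)) := by
    intro Q
    have := (torusProj_quot n).continuous
    fun_prop
  have hint : ∀ Q : C(UnitAddTorus (Fin n), ℂ), Integrable Q (torusMeas n) := fun Q =>
    Q.continuous.integrable_of_hasCompactSupport (HasCompactSupport.of_compactSpace _)
  have hm : 0 < ∫ y, f y ∂(torusMeas n) :=
    f.continuous.integral_pos_of_hasCompactSupport_nonneg_nonzero
      (HasCompactSupport.of_compactSpace _) hf hf0
  set m := ∫ y, f y ∂(torusMeas n) with hmdef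
  let g : C(UnitAddTorus (Fin n), ℂ) := ⟨fun y => (f y : ℂ), by fun_prop⟩
  have hg : g ∈ (Submodule.span ℂ (Set.range (UnitAddTorus.mFourier (d := Fin n)))).topologicalClosure := by
    rw [UnitAddTorus.span_mFourier_closure_eq_top]; trivial
  obtain ⟨P, hP, hPg⟩ := Metric.mem_closure_iff.mp hg (m / 4) (by positivity)
  have hPg' : ∀ y, ‖g y - P y‖ ≤ m / 4 := fun y => by
    have := ContinuousMap.dist_apply_le_dist (f := g) (g := P) y
    rw [dist_eq_norm] at this
    exact this.trans hPg.le
  obtain ⟨C, hC⟩ := weyl_span x v hv P hP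
  have key : ∀ T : ℝ, 0 ≤ T → T * (m / 2) - C ≤ ∫ s in (0:ℝ)..T, f (torusProj n (x + s • v)) := by
    intro T hT
    have h1 : ‖∫ s in (0:ℝ)..T, (g (torusProj n (x + s • v)) - P (torusProj n (x + s • v)))‖
        ≤ m / 4 * |T - 0| := intervalIntegral.norm_integral_le_of_norm_le_const fun s _ => hPg' _
    rw [intervalIntegral.integral_sub ((hcl g).intervalIntegrable _ _)
      ((hcl P).intervalIntegrable _ _), sub_zero, abs_of_nonneg hT] at h1
    have h2 : ‖∫ y, (g y - P y) ∂(torusMeas n)‖ ≤ m / 4 := by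
      have := norm_integral_le_of_norm_le_const (μ := torusMeas n)
        (Filter.Eventually.of_forall hPg')
      simpa using this
    rw [integral_sub (hint g) (hint P)] at h2
    have hgi : ∫ y, g y ∂(torusMeas n) = (m : ℂ) := integral_ofReal
    have hgl : (∫ s in (0:ℝ)..T, g (torusProj n (x + s • v))) =
      ((∫ s in (0:ℝ)..T, f (torusProj n (x + s • v)) : ℝ) : ℂ) := intervalIntegral.integral_ofReal
    rw [hgi] at h2
    rw [hgl] at h1
    have h3 := hC T
    have r1 := (abs_le.mp ((Complex.abs_re_le_norm _).trans h1)).1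
    have r2 := (abs_le.mp ((Complex.abs_re_le_norm _).trans h2)).2
    have r3 := (abs_le.mp ((Complex.abs_re_le_norm _).trans h3)).1
    simp only [Complex.sub_re, Complex.ofReal_re, Complex.re_ofReal_mul] at r1 r2 r3
    nlinarith
  refine tendsto_atTop_mono' atTop (f₁ := fun T => T * (m / 2) - C) ?_ ?_
  · filter_upwards [eventually_ge_atTop 0] with T hT using key T hT
  · exact tendsto_atTop_add_const_right _ _ (tendsto_id.atTop_mul_const (by positivity))

/-- Descent of a periodic function. -/
lemma line_unbounded {n : ℕ} (ψ : EuclideanSpace ℝ (Fin n) → ℝ) (hc : Continuous ψ)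
    (h0 : ∀ z, 0 ≤ ψ z) (hp : ∀ z (k : Fin n → ℤ), ψ (z + latticePoint k) = ψ z)
    (hne : ψ 0 ≠ 0) (x v : EuclideanSpace ℝ (Fin n))
    (hv : ∀ k : Fin n → ℤ, k ≠ 0 → ∑ a, (k a : ℝ) * v a ≠ 0) :
    Tendsto (fun T : ℝ => ∫ s in (0:ℝ)..T, ψ (x + s • v)) atTop atTop := by
  let S : (Fin n → ℝ) → EuclideanSpace ℝ (Fin n) := fun y => WithLp.toLp 2 ((2 * Real.pi) • y)
  have hS : Continuous S := by fun_prop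
  have hfac : Function.FactorsThrough (ψ ∘ S) (torusProj n) := by
    intro y z hyz
    have : ∀ a, ∃ k : ℤ, z a + k = y a := by
      intro a
      have h := congrFun hyz a
      simp only [torusProj, Pi.map_apply] at h
      have h' : ((y a - z a : ℝ) : UnitAddCircle) = 0 := by
        rw [AddCircle.coe_sub, h, sub_self]
      obtain ⟨k, hk⟩ := (AddCircle.coe_eq_zero_iff 1).mp h'
      refine ⟨k, ?_⟩
      simp at hk
      linarith
    choose k hk using this
    have : S y = S z + latticePoint k := by
      ext a
      simp only [S, latticePoint]
      simp [← hk a]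
      ring
    simp only [Function.comp_apply, this, hp]
  let f : C(UnitAddTorus (Fin n), ℝ) :=
    Topology.IsQuotientMap.lift (f := ⟨torusProj n, (torusProj_quot n).continuous⟩) (torusProj_quot n).isQuotientMap ⟨ψ ∘ S, hc.comp hS⟩ hfac
  have hf : ∀ y, f (torusProj n y) = ψ (S y) := fun y => by
    exact congrFun (congrArg DFunLike.coe (Topology.IsQuotientMap.lift_comp (f := ⟨torusProj n, (torusProj_quot n).continuous⟩) (torusProj_quot n).isQuotientMap ⟨ψ ∘ S, hc.comp hS⟩ hfac)) y
  have hpi := Real.pi_pos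
  have := weyl_unbounded (n := n) ((2 * Real.pi)⁻¹ • (x : Fin n → ℝ)) ((2 * Real.pi)⁻¹ • (v : Fin n → ℝ)) ?_ f ?_
    (torusProj n 0) ?_
  · simp only [hf] at this
    convert this using 5 with T s
    ext a
    simp only [S]
    simp
    field_simp
  · intro k hk h
    apply hv k hk
    have e : ∑ a, (k a : ℝ) * ((2 * Real.pi)⁻¹ • (v : Fin n → ℝ)) a
      = (2 * Real.pi)⁻¹ * ∑ a, (k a : ℝ) * v a := by
      rw [Finset.mul_sum]
      refine Finset.sum_congr rfl fun a _ => ?_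
      simp; ring
    rw [e] at h
    exact (mul_eq_zero.mp h).resolve_left (by positivity)
  · intro y
    obtain ⟨z, rfl⟩ := (torusProj_quot n).surjective y
    rw [hf]; exact h0 _
  · rw [hf]
    convert hne
    simp [S]

lemma const_of_deriv {E : Type*} [NormedAddCommGroup E] [NormedSpace ℝ E] (f : ℝ → E)
    (hf : ∀ t ∈ Ici (0:ℝ), HasDerivWithinAt f 0 (Ici 0) t) (t : ℝ) (ht : 0 ≤ t) : f t = f 0 := by
  refine constant_of_has_deriv_right_zero (a := 0) (b := t) ?_ ?_ t ⟨ht, le_rfl⟩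
  · intro s hs
    exact (hf s hs.1).continuousWithinAt.mono Icc_subset_Ici_self
  · intro s hs
    exact (hf s hs.1).mono (Ici_subset_Ici.mpr hs.1)

lemma ode_align {E : Type*} [NormedAddCommGroup E] [NormedSpace ℝ E] (ψ : E → ℝ)
    (hc : Continuous ψ) (h0 : ∀ z, 0 ≤ ψ z) (x v : ℝ → E)
    (hx : ∀ t ∈ Ici (0:ℝ), HasDerivWithinAt x (v t) (Ici 0) t)
    (hv : ∀ t ∈ Ici (0:ℝ), HasDerivWithinAt v (-ψ (x t) • v t) (Ici 0) t)
    (hub : Tendsto (fun T : ℝ => ∫ s in (0:ℝ)..T, ψ (x 0 + s • v 0)) atTop atTop) :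
    Tendsto (fun t => ‖v t‖) atTop (nhds 0) := by
  have hxc : ContinuousOn x (Ici 0) := fun t ht => (hx t ht).continuousWithinAt
  let q : ℝ → ℝ := fun t => ψ (x (max t 0))
  have hq : Continuous q := by
    refine hc.comp (hxc.comp_continuous (by fun_prop) fun t => mem_Ici.mpr (le_max_right _ _))
  have hqe : ∀ t, 0 ≤ t → q t = ψ (x t) := fun t ht => by simp [q, ht]
  let A : ℝ → ℝ := fun t => ∫ s in (0:ℝ)..t, q s
  have hA : ∀ t, HasDerivAt A (q t) t := fun t => hq.integral_hasStrictDerivAt 0 t |>.hasDerivAt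
  let m : ℝ → ℝ := fun t => Real.exp (-A t)
  have hm : ∀ t, HasDerivAt m (m t * (-q t)) t := fun t => (hA t).neg.exp
  have hmc : Continuous m := continuous_iff_continuousAt.mpr fun t => (hm t).continuousAt
  have hA0 : A 0 = 0 := by simp [A]
  have hm0 : m 0 = 1 := by simp [m, hA0]
  have hvm : ∀ t, 0 ≤ t → v t = m t • v 0 := by
    intro t ht
    have := const_of_deriv (fun t => Real.exp (A t) • v t) ?_ t ht
    · simp only [hA0, Real.exp_zero, one_smul] at this
      rw [← this, smul_smul, ← Real.exp_add]
      simp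
    · intro s hs
      have h := ((hA s).exp.hasDerivWithinAt (s := Ici 0)).smul (hv s hs)
      refine HasDerivWithinAt.congr_deriv h ?_
      rw [hqe s hs, smul_smul, ← add_smul]
      simp
  let S : ℝ → ℝ := fun t => ∫ s in (0:ℝ)..t, m s
  have hS : ∀ t, HasDerivAt S (m t) t := fun t => hmc.integral_hasStrictDerivAt 0 t |>.hasDerivAt
  have hS0 : S 0 = 0 := by simp [S]
  have hxS : ∀ t, 0 ≤ t → x t = x 0 + S t • v 0 := by
    intro t ht
    have := const_of_deriv (fun t => x t - S t • v 0) ?_ t ht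
    · simp only [hS0, zero_smul, sub_zero] at this
      rw [← this]; abel
    · intro s hs
      have h := (hx s hs).sub (((hS s).smul_const (v 0)).hasDerivWithinAt (s := Ici 0))
      refine HasDerivWithinAt.congr_deriv h ?_
      rw [hvm s hs, sub_self]
  let p : ℝ → ℝ := fun s => ψ (x 0 + s • v 0)
  have hp : Continuous p := by fun_prop
  let G : ℝ → ℝ := fun T => ∫ s in (0:ℝ)..T, p s
  have hG : ∀ t, HasDerivAt G (p t) t := fun t => hp.integral_hasStrictDerivAt 0 t |>.hasDerivAt
  have hG0 : G 0 = 0 := by simp [G]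
  have hGS : ∀ t, 0 ≤ t → m t + G (S t) = 1 := by
    intro t ht
    have := const_of_deriv (fun t => m t + G (S t)) ?_ t ht
    · simpa [hm0, hS0, hG0] using this
    · intro s hs
      have h := ((hm s).add ((hG (S s)).comp s (hS s))).hasDerivWithinAt (s := Ici 0)
      refine HasDerivWithinAt.congr_deriv h ?_
      have : p (S s) = q s := by rw [hqe s hs, hxS s hs]
      rw [this]; ring
  have hmpos : ∀ t, 0 < m t := fun t => Real.exp_pos _
  have hmanti : Antitone m := by
    refine antitone_of_hasDerivAt_nonpos hm fun t => ?_
    have := mul_nonneg (hmpos t).le (h0 (x (max t 0)))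
    simp only [Pi.zero_apply, mul_neg]; simp only [q]; linarith
  obtain ⟨B, hB⟩ := (eventually_atTop.mp (hub.eventually_gt_atTop 1))
  have hSB : ∀ t, 0 ≤ t → S t ≤ B := by
    intro t ht
    by_contra! h
    have h1 : 1 < G (S t) := hB (S t) h.le
    linarith [hGS t ht, hmpos t]
  have hmS : ∀ t, 0 ≤ t → t * m t ≤ S t := by
    intro t ht
    have : ∫ s in (0:ℝ)..t, m t ≤ ∫ s in (0:ℝ)..t, m s := by
      refine intervalIntegral.integral_mono_on ht (by simp) (hmc.intervalIntegrable _ _) ?_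
      intro s hs
      exact hmanti hs.2
    simpa using this
  have hlim : Tendsto m atTop (nhds 0) := by
    refine squeeze_zero' (g := fun t => B / t) (Eventually.of_forall fun t => (hmpos t).le) ?_
      (tendsto_const_nhds.div_atTop tendsto_id)
    filter_upwards [eventually_gt_atTop 0] with t ht
    rw [le_div_iff₀ ht]
    linarith [hmS t ht.le, hSB t ht.le]
  have := hlim.mul_const ‖v 0‖
  rw [zero_mul] at this
  refine this.congr' ?_
  filter_upwards [eventually_ge_atTop 0] with t ht
  rw [hvm t ht, norm_smul, Real.norm_of_nonneg (hmpos t).le]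

lemma ae_indep (n : ℕ) : ∀ᵐ d ∂(volume : Measure ((Fin 2 → EuclideanSpace ℝ (Fin n)) ×
        (Fin 2 → EuclideanSpace ℝ (Fin n)))),
      ∀ k : Fin n → ℤ, k ≠ 0 → ∑ a, (k a : ℝ) * (d.2 0 - d.2 1) a ≠ 0 := by
  rw [ae_all_iff]
  intro k
  by_cases hk : k = 0
  · simp [hk]
  let L : ((Fin 2 → EuclideanSpace ℝ (Fin n)) × (Fin 2 → EuclideanSpace ℝ (Fin n))) →ₗ[ℝ] ℝ :=
    { toFun := fun d => ∑ a, (k a : ℝ) * (d.2 0 - d.2 1) a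
      map_add' := fun d e => by
        rw [← Finset.sum_add_distrib]
        refine Finset.sum_congr rfl fun a _ => ?_
        simp; ring
      map_smul' := fun c d => by
        simp only [RingHom.id_apply, smul_eq_mul]
        rw [Finset.mul_sum]
        refine Finset.sum_congr rfl fun a _ => ?_
        simp; ring }
  have : Measure.IsAddHaarMeasure (volume : Measure ((Fin 2 → EuclideanSpace ℝ (Fin n)) ×
        (Fin 2 → EuclideanSpace ℝ (Fin n)))) := Measure.prod.instIsAddHaarMeasure _ _
  have hker : LinearMap.ker L ≠ ⊤ := by
    intro h
    obtain ⟨i, hi⟩ := Function.ne_iff.mp hk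
    have : L (0, ![EuclideanSpace.single i 1, 0]) = 0 := by
      rw [← LinearMap.mem_ker, h]; trivial
    simp [L] at this
    exact hi (by simpa using this)
  have := Measure.addHaar_submodule volume (LinearMap.ker L) hker
  filter_upwards [measure_eq_zero_iff_ae_notMem.mp this] with d hd _ h
  exact hd (LinearMap.mem_ker.mpr h)

/-- **Generic Alignment for N = 2.** For a.e. initial datum
`(x₀, v₀) ∈ [0,2π)^{2n} × ℝ^{2n}`, the solution of the periodic two-agent
Cucker–Smale system aligns: `|v₁(t) − v₂(t)| → 0` as `t → ∞`. -/
theorem stmt11 (n : ℕ) (hn : 1 ≤ n)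
    (r₀ : ℝ) (hr₀ : 0 < r₀) (hr₀pi : r₀ < Real.pi)
    (φ : EuclideanSpace ℝ (Fin n) → ℝ)
    (hφC1 : ContDiff ℝ 1 φ) (hφnonneg : ∀ z, 0 ≤ φ z)
    (hφper : ∀ z (k : Fin n → ℤ), φ (z + latticePoint k) = φ z)
    (hφsupp : ∀ z, 0 < φ z ↔ dTorus z < r₀)
    (X V : (Fin 2 → EuclideanSpace ℝ (Fin n)) × (Fin 2 → EuclideanSpace ℝ (Fin n)) →
      ℝ → Fin 2 → EuclideanSpace ℝ (Fin n))
    (hinit : ∀ d, X d 0 = d.1 ∧ V d 0 = d.2)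
    (hX : ∀ d i, ∀ t ∈ Set.Ici (0 : ℝ),
      HasDerivWithinAt (fun s => X d s i) (V d t i) (Set.Ici 0) t)
    (hV : ∀ d i, ∀ t ∈ Set.Ici (0 : ℝ),
      HasDerivWithinAt (fun s => V d s i)
        ((2 : ℝ)⁻¹ • ∑ j, φ (X d t i - X d t j) • (V d t j - V d t i)) (Set.Ici 0) t) :
    ∀ᵐ d ∂(volume : Measure ((Fin 2 → EuclideanSpace ℝ (Fin n)) ×
        (Fin 2 → EuclideanSpace ℝ (Fin n)))),
      (∀ i a, d.1 i a ∈ Set.Ico (0 : ℝ) (2 * Real.pi)) →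
      Tendsto (fun t => ‖V d t 0 - V d t 1‖) atTop (nhds 0) := by
  have hper2 : ∀ z (k : Fin n → ℤ), φ (-(z + latticePoint k)) = φ (-z) := by
    intro z k
    have : -(z + latticePoint k) = -z + latticePoint (-k) := by
      ext a
      simp [latticePoint]
      ring
    rw [this, hφper]
  have hφ0 : 0 < φ 0 := by
    rw [hφsupp]
    refine lt_of_le_of_lt (ciInf_le ⟨0, ?_⟩ (0 : Fin n → ℤ)) ?_
    · rintro _ ⟨k, rfl⟩
      exact norm_nonneg _
    · have : latticePoint (0 : Fin n → ℤ) = 0 := by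
        ext a; simp [latticePoint]
      simpa [this] using hr₀
  have hφc := hφC1.continuous
  let ψ : EuclideanSpace ℝ (Fin n) → ℝ := fun z => 2⁻¹ * (φ z + φ (-z))
  have hψc : Continuous ψ := by fun_prop
  have hψ0 : ∀ z, 0 ≤ ψ z := fun z => by
    have := hφnonneg z
    have := hφnonneg (-z)
    positivity
  filter_upwards [ae_indep n] with d hd _
  refine ode_align ψ hψc hψ0 (fun t => X d t 0 - X d t 1) (fun t => V d t 0 - V d t 1) ?_ ?_ ?_
  · intro t ht
    exact (hX d 0 t ht).sub (hX d 1 t ht)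
  · intro t ht
    refine HasDerivWithinAt.congr_deriv ((hV d 0 t ht).sub (hV d 1 t ht)) ?_
    have e : X d t 1 - X d t 0 = -(X d t 0 - X d t 1) := by abel
    simp only [Fin.sum_univ_two, sub_self, smul_zero, zero_add, add_zero, e, ψ]
    module
  · refine line_unbounded ψ hψc hψ0 ?_ ?_ _ _ ?_
    · intro z k
      simp only [ψ, hper2, hφper]
    · simp only [ψ, neg_zero]
      positivity
    · simpa [(hinit d).2] using hd
end
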